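/- Let A be a commutative Noetherian ring of Krull dimension one, let π ∈ A be an element such that the Krull dimension of A/πA is zero, and let R = A[x_1,...,x_n] be a polynomial ring over A. Then for every ideal I of R and every integer i ≥ 0, the set of associated primes of H^i_I(R) that contain π is finite. -/

import Mathlib

/-!
STATEMENT 4: Let `A` be a commutative Noetherian ring of Krull dimension one, let
`π ∈ A` be such that `dim (A/πA) = 0`, and let `R` be a polynomial ring in `n`
variables over `A`.  Then for every ideal `I` of `R` and every `i ≥ 0`, the set of
associated primes of `H^i_I(R)` that contain `π` is finite.
-/

universe u

open CategoryTheory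

set_option linter.unusedSectionVars false

namespace LCF
open CategoryTheory Limits Opposite
noncomputable section
section ExtRep
variable {R : Type u} [CommRing R]

/-- The Hom complex of a projective resolution, as a complex in the opposite category. -/
abbrev homCx {X : ModuleCat.{u} R} (P : ProjectiveResolution X) (Y : ModuleCat.{u} R) :
    ChainComplex (ModuleCat.{u} R)ᵒᵖ ℕ :=
  (((linearYoneda R (ModuleCat.{u} R)).obj Y).rightOp.mapHomologicalComplex _).obj P.complex

abbrev ExtO (i : ℕ) (X Y : ModuleCat.{u} R) : ModuleCat.{u} R :=
  ((Ext R (ModuleCat.{u} R) i).obj (op X)).obj Y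

abbrev zObj {X : ModuleCat.{u} R} (P : ProjectiveResolution X) (i : ℕ) (Y : ModuleCat.{u} R) :
    ModuleCat.{u} R := ((homCx P Y).opcycles i).unop

def zi {X : ModuleCat.{u} R} (P : ProjectiveResolution X) (i : ℕ) (Y : ModuleCat.{u} R) :
    zObj P i Y ⟶ ModuleCat.of R (P.complex.X i ⟶ Y) := ((homCx P Y).pOpcycles i).unop

def ldIso {X : ModuleCat.{u} R} (P : ProjectiveResolution X) (i : ℕ) (Y : ModuleCat.{u} R) :
    (((linearYoneda R (ModuleCat.{u} R)).obj Y).rightOp.leftDerived i).obj X ≅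
      (homCx P Y).homology i :=
  P.isoLeftDerivedObj ((linearYoneda R (ModuleCat.{u} R)).obj Y).rightOp i

def ldHom {X : ModuleCat.{u} R} (P : ProjectiveResolution X) (i : ℕ) (Y : ModuleCat.{u} R) :
    ((homCx P Y).homology i).unop ⟶ ExtO i X Y := (ldIso P i Y).hom.unop

lemma ldHom_inj {X : ModuleCat.{u} R} (P : ProjectiveResolution X) (i : ℕ) (Y : ModuleCat.{u} R) :
    Function.Injective (ldHom P i Y).hom := by
  have : Mono (ldHom P i Y) := unop_mono_of_epi (ldIso P i Y).hom
  exact (ModuleCat.mono_iff_injective _).1 this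

def zp {X : ModuleCat.{u} R} (P : ProjectiveResolution X) (i : ℕ) (Y : ModuleCat.{u} R) :
    zObj P i Y ⟶ ExtO i X Y :=
  ((homCx P Y).homologyι i).unop ≫ ldHom P i Y

lemma ldIso_natY {X : ModuleCat.{u} R} (P : ProjectiveResolution X) (i : ℕ)
    {Y Y' : ModuleCat.{u} R} (h : Y ⟶ Y') :
    (NatTrans.leftDerived (((linearYoneda R (ModuleCat.{u} R)).map h).rightOp) i).app X ≫
      (ldIso P i Y).hom = (ldIso P i Y').hom ≫ HomologicalComplex.homologyMap
        ((NatTrans.mapHomologicalComplex (((linearYoneda R (ModuleCat.{u} R)).map h).rightOp) _).app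
          P.complex) i := by
  rw [ProjectiveResolution.leftDerived_app_eq _ P i, Category.assoc, Category.assoc]
  congr 1
  exact (congrArg (fun t => _ ≫ t) (P.isoLeftDerivedObj
    ((linearYoneda R (ModuleCat.{u} R)).obj Y).rightOp i).inv_hom_id).trans (Category.comp_id _)

lemma ldIso_natX {X X' : ModuleCat.{u} R} (P : ProjectiveResolution X)
    (P' : ProjectiveResolution X') (i : ℕ) (Y : ModuleCat.{u} R) (f : X' ⟶ X)
    (κ : P'.complex ⟶ P.complex) (comm : κ.f 0 ≫ P.π.f 0 = P'.π.f 0 ≫ f) :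
    (((linearYoneda R (ModuleCat.{u} R)).obj Y).rightOp.leftDerived i).map f ≫
      (ldIso P i Y).hom = (ldIso P' i Y).hom ≫ HomologicalComplex.homologyMap
        ((((linearYoneda R (ModuleCat.{u} R)).obj Y).rightOp.mapHomologicalComplex _).map κ) i :=
  ProjectiveResolution.isoLeftDerivedObj_hom_naturality f P' P κ comm
      ((linearYoneda R (ModuleCat.{u} R)).obj Y).rightOp i

def ERep {X : ModuleCat.{u} R} (P : ProjectiveResolution X) (i : ℕ) (Y : ModuleCat.{u} R)
    (φ : P.complex.X i ⟶ Y) (x : ExtO i X Y) : Prop :=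
  ∃ z : zObj P i Y, (zi P i Y).hom z = φ ∧ (zp P i Y).hom z = x

variable {X : ModuleCat.{u} R} (P : ProjectiveResolution X) (i : ℕ) (Y : ModuleCat.{u} R)

lemma zi_inj : Function.Injective (zi P i Y).hom := by
  have : Mono (zi P i Y) := unop_mono_of_epi ((homCx P Y).pOpcycles i)
  exact (ModuleCat.mono_iff_injective _).1 this

lemma zp_surj : Function.Surjective (zp P i Y).hom := by
  have : Epi (zp P i Y) := by
    have h1 : Epi ((homCx P Y).homologyι i).unop := unop_epi_of_mono _
    have h2 : Epi (ldHom P i Y) := unop_epi_of_mono (ldIso P i Y).hom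
    exact epi_comp _ _
  exact (ModuleCat.epi_iff_surjective _).1 this

lemma ERep.add {φ ψ x y} (h : ERep P i Y φ x) (h' : ERep P i Y ψ y) :
    ERep P i Y (φ + ψ) (x + y) := by
  obtain ⟨z, rfl, rfl⟩ := h
  obtain ⟨w, rfl, rfl⟩ := h'
  exact ⟨z + w, map_add _ _ _, map_add _ _ _⟩

lemma ERep.smul (r : R) {φ x} (h : ERep P i Y φ x) :
    ERep P i Y (r • φ) (r • x) := by
  obtain ⟨z, rfl, rfl⟩ := h
  exact ⟨r • z, map_smul _ _ _, map_smul _ _ _⟩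

lemma ERep.exists (x : ExtO i X Y) : ∃ φ, ERep P i Y φ x := by
  obtain ⟨z, hz⟩ := zp_surj P i Y x
  exact ⟨_, z, rfl, hz⟩

lemma ERep.cocycle {φ x} (h : ERep P i Y φ x) : P.complex.d (i+1) i ≫ φ = 0 := by
  obtain ⟨z, rfl, rfl⟩ := h
  have h := congrArg Quiver.Hom.unop ((homCx P Y).d_pOpcycles (i+1) i)
  exact congrArg (fun f => f.hom z) h

lemma ERep.of_cocycle {φ : P.complex.X i ⟶ Y} (h : P.complex.d (i+1) i ≫ φ = 0) :
    ∃ x, ERep P i Y φ x := by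
  have hex : (ShortComplex.mk _ _ ((homCx P Y).d_pOpcycles (i+1) i)).Exact :=
    ShortComplex.exact_of_g_is_cokernel _ ((homCx P Y).opcyclesIsCokernel (i+1) i (by simp))
  have hex2 := hex.unop
  rw [ShortComplex.moduleCat_exact_iff] at hex2
  obtain ⟨z, hz⟩ := hex2 φ h
  exact ⟨_, z, hz, rfl⟩

lemma ERep.boundary {φ : P.complex.X (i+1) ⟶ Y} (h : ERep P (i+1) Y φ 0) :
    ∃ χ : P.complex.X i ⟶ Y, φ = P.complex.d (i+1) i ≫ χ := by
  obtain ⟨z, rfl, hz⟩ := h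
  have hex : (ShortComplex.mk _ _ ((homCx P Y).homologyι_comp_fromOpcycles (i+1) i)).Exact :=
    ShortComplex.exact_of_f_is_kernel _ ((homCx P Y).homologyIsKernel (i+1) i (by simp))
  have hex2 := hex.unop
  rw [ShortComplex.moduleCat_exact_iff] at hex2
  obtain ⟨χ, hχ⟩ := hex2 z (by
    exact ldHom_inj P (i+1) Y (Eq.trans hz (map_zero (ldHom P (i+1) Y).hom).symm))
  refine ⟨χ, ?_⟩
  have h3 := congrArg Quiver.Hom.unop ((homCx P Y).p_fromOpcycles (i+1) i)
  rw [← hχ]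
  exact congrArg (fun f => f.hom χ) h3

lemma ERep.of_boundary (χ : P.complex.X i ⟶ Y) :
    ERep P (i+1) Y (P.complex.d (i+1) i ≫ χ) 0 := by
  refine ⟨((homCx P Y).fromOpcycles (i+1) i).unop.hom χ, ?_, ?_⟩
  · have h3 := congrArg Quiver.Hom.unop ((homCx P Y).p_fromOpcycles (i+1) i)
    exact congrArg (fun f => f.hom χ) h3
  · have h3 := congrArg Quiver.Hom.unop ((homCx P Y).homologyι_comp_fromOpcycles (i+1) i)
    have h4 := congrArg (fun f => f.hom χ) h3
    have h5 : (((homCx P Y).homologyι (i+1)).unop).hom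
      (((homCx P Y).fromOpcycles (i+1) i).unop.hom χ) = 0 := h4
    exact (congrArg (ldHom P (i+1) Y).hom h5).trans (map_zero _)

lemma ERep.zero_zero {φ : P.complex.X 0 ⟶ Y} (h : ERep P 0 Y φ 0) : φ = 0 := by
  obtain ⟨z, rfl, hz⟩ := h
  have hex : (ShortComplex.mk _ _ ((homCx P Y).homologyι_comp_fromOpcycles 0 0)).Exact :=
    ShortComplex.exact_of_f_is_kernel _ ((homCx P Y).homologyIsKernel 0 0 (by simp))
  have hex2 := hex.unop
  rw [ShortComplex.moduleCat_exact_iff] at hex2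
  obtain ⟨χ, hχ⟩ := hex2 z (by
    exact ldHom_inj P 0 Y (Eq.trans hz (map_zero (ldHom P 0 Y).hom).symm))
  have h4 : (homCx P Y).fromOpcycles 0 0 = 0 := (homCx P Y).fromOpcycles_eq_zero (by simp)
  have h5 : z = 0 := by
    rw [← hχ]
    exact congrArg (fun f => f.unop.hom χ) h4
  rw [h5, map_zero]

lemma ERep.uniq {φ x y} (h : ERep P i Y φ x) (h' : ERep P i Y φ y) : x = y := by
  obtain ⟨z, hz, rfl⟩ := h
  obtain ⟨w, hw, rfl⟩ := h'
  rw [zi_inj P i Y (hz.trans hw.symm)]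

lemma ERep.mapY {Y' : ModuleCat.{u} R} (h : Y ⟶ Y') {φ x} (H : ERep P i Y φ x) :
    ERep P i Y' (φ ≫ h) ((((Ext R (ModuleCat.{u} R) i).obj (op X)).map h).hom x) := by
  obtain ⟨z, rfl, rfl⟩ := H
  let α := (((linearYoneda R (ModuleCat.{u} R)).map h).rightOp)
  let κ : homCx P Y' ⟶ homCx P Y := (NatTrans.mapHomologicalComplex α _).app P.complex
  refine ⟨(HomologicalComplex.opcyclesMap κ i).unop.hom z, ?_, ?_⟩
  · exact congrArg (fun f => f.unop.hom z) (HomologicalComplex.p_opcyclesMap κ i)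
  · have e1 : ((Ext R (ModuleCat.{u} R) i).obj (op X)).map h =
      ((NatTrans.leftDerived α i).app X).unop := rfl
    have e2 : ((NatTrans.leftDerived α i).app X ≫ (ldIso P i Y).hom) ≫ (homCx P Y).homologyι i =
        ((ldIso P i Y').hom ≫ (homCx P Y').homologyι i) ≫ HomologicalComplex.opcyclesMap κ i := by
      rw [ldIso_natY, Category.assoc, Category.assoc, HomologicalComplex.homologyι_naturality]
    exact (congrArg (fun f => f.unop.hom z) e2).symm

lemma ERep.mapX {X' : ModuleCat.{u} R} (P' : ProjectiveResolution X') (f : X' ⟶ X)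
    (κ : P'.complex ⟶ P.complex) (comm : κ.f 0 ≫ P.π.f 0 = P'.π.f 0 ≫ f)
    {φ x} (H : ERep P i Y φ x) :
    ERep P' i Y (κ.f i ≫ φ) ((((Ext R (ModuleCat.{u} R) i).map f.op).app Y).hom x) := by
  obtain ⟨z, rfl, rfl⟩ := H
  let κ' : homCx P' Y ⟶ homCx P Y :=
    (((linearYoneda R (ModuleCat.{u} R)).obj Y).rightOp.mapHomologicalComplex _).map κ
  refine ⟨(HomologicalComplex.opcyclesMap κ' i).unop.hom z, ?_, ?_⟩
  · exact congrArg (fun f => f.unop.hom z) (HomologicalComplex.p_opcyclesMap κ' i)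
  · have e1 : ((Ext R (ModuleCat.{u} R) i).map f.op).app Y =
      ((((linearYoneda R (ModuleCat.{u} R)).obj Y).rightOp.leftDerived i).map f).unop := rfl
    have e2 : ((((linearYoneda R (ModuleCat.{u} R)).obj Y).rightOp.leftDerived i).map f ≫
        (ldIso P i Y).hom) ≫ (homCx P Y).homologyι i =
        ((ldIso P' i Y).hom ≫ (homCx P' Y).homologyι i) ≫ HomologicalComplex.opcyclesMap κ' i := by
      rw [ldIso_natX P P' i Y f κ comm, Category.assoc, Category.assoc,
        HomologicalComplex.homologyι_naturality]
    exact (congrArg (fun f => f.unop.hom z) e2).symm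

end ExtRep
end
end LCF

namespace LCF
open CategoryTheory Limits Opposite
noncomputable section
section LCRep
variable {R : Type u} [CommRing R] (I : Ideal R)

abbrev QI (t : ℕ) : ModuleCat.{u} R :=
  (localCohomology.ringModIdeals (localCohomology.idealPowersDiagram I)).obj (op t)

abbrev qI {t s : ℕ} (h : t ≤ s) : QI I s ⟶ QI I t :=
  (localCohomology.ringModIdeals (localCohomology.idealPowersDiagram I)).map (homOfLE h).op

abbrev PR (t : ℕ) : ProjectiveResolution (QI I t) := projectiveResolution _

def kI {t s : ℕ} (h : t ≤ s) : (PR I s).complex ⟶ (PR I t).complex :=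
  ProjectiveResolution.lift (qI I h) _ _

lemma kI_comm {t s : ℕ} (h : t ≤ s) :
    (kI I h).f 0 ≫ (PR I t).π.f 0 = (PR I s).π.f 0 ≫ qI I h :=
  ProjectiveResolution.lift_commutes_zero _ _ _

abbrev LC (i : ℕ) (M : ModuleCat.{u} R) : ModuleCat.{u} R := (localCohomology I i).obj M

instance hasColim (i : ℕ) : HasColimit
    (localCohomology.diagram (localCohomology.idealPowersDiagram I) i) :=
  localCohomology.hasColimitDiagram.{u, 0} _ i

def cI (i : ℕ) : Cocone (localCohomology.diagram (localCohomology.idealPowersDiagram I) i) :=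
  colimit.cocone _

def cIc (i : ℕ) : IsColimit (cI I i) := colimit.isColimit _

lemma cI_pt (i : ℕ) : (cI I i).pt = localCohomology I i := rfl

def lI (i t : ℕ) (M : ModuleCat.{u} R) : ExtO i (QI I t) M ⟶ LC I i M :=
  ((cI I i).ι.app (op (op t))).app M

lemma lI_nat (i t : ℕ) {M N : ModuleCat.{u} R} (g : M ⟶ N) (x : ExtO i (QI I t) M) :
    (lI I i t N).hom ((((Ext R (ModuleCat.{u} R) i).obj (op (QI I t))).map g).hom x) =
      ((localCohomology I i).map g).hom ((lI I i t M).hom x) :=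
  congrArg (fun f => f.hom x) (((cI I i).ι.app (op (op t))).naturality g)

lemma lI_trans (i : ℕ) {t s : ℕ} (h : t ≤ s) (M : ModuleCat.{u} R) (x : ExtO i (QI I t) M) :
    (lI I i s M).hom ((((Ext R (ModuleCat.{u} R) i).map (qI I h).op).app M).hom x) =
      (lI I i t M).hom x :=
  congrArg (fun f => (f.app M).hom x) ((cI I i).w (homOfLE h).op.op)

instance forgetPres : PreservesColimitsOfShape (ℕᵒᵖ)ᵒᵖ (forget (ModuleCat.{u} R)) := by
  have : PreservesFilteredColimitsOfSize.{0, 0} (forget (ModuleCat.{u} R)) :=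
    preservesFilteredColimitsOfSize_shrink.{0, u, 0, u} (forget (ModuleCat.{u} R))
  infer_instance

lemma lI_exists (i : ℕ) (M : ModuleCat.{u} R) (x : LC I i M) :
    ∃ t y, (lI I i t M).hom y = x := by
  have hc := isColimitOfPreserves ((evaluation (ModuleCat.{u} R) (ModuleCat.{u} R)).obj M)
    (cIc I i)
  have : PreservesColimitsOfShape (ℕᵒᵖ)ᵒᵖ (forget (ModuleCat.{u} R)) := forgetPres
  obtain ⟨j, y, hy⟩ := Concrete.isColimit_exists_rep _ hc x
  exact ⟨j.unop.unop, y, hy⟩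

lemma lI_zero (i t : ℕ) (M : ModuleCat.{u} R) (x : ExtO i (QI I t) M)
    (hx : (lI I i t M).hom x = 0) :
    ∃ (s : ℕ) (h : t ≤ s), (((Ext R (ModuleCat.{u} R) i).map (qI I h).op).app M).hom x = 0 := by
  have hc := isColimitOfPreserves ((evaluation (ModuleCat.{u} R) (ModuleCat.{u} R)).obj M)
    (cIc I i)
  have := (IsColimit.eq_iff' hc (i := op (op t)) x 0).1 (by
    refine Eq.trans hx ?_
    exact (map_zero (lI I i t M).hom).symm)
  obtain ⟨j, f, hf⟩ := this
  refine ⟨j.unop.unop, f.unop.unop.le, ?_⟩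
  refine Eq.trans hf ?_
  exact map_zero ((((localCohomology.diagram (localCohomology.idealPowersDiagram I) i)).map f).app M).hom

def LRep (i t : ℕ) (M : ModuleCat.{u} R) (φ : (PR I t).complex.X i ⟶ M) (x : LC I i M) : Prop :=
  ∃ y, ERep (PR I t) i M φ y ∧ (lI I i t M).hom y = x

variable {I} {i t : ℕ} {M N : ModuleCat.{u} R}

lemma LRep.exists (x : LC I i M) : ∃ t φ, LRep I i t M φ x := by
  obtain ⟨t, y, hy⟩ := lI_exists I i M x
  obtain ⟨φ, hφ⟩ := ERep.exists (PR I t) i M y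
  exact ⟨t, φ, y, hφ, hy⟩

lemma LRep.add {φ ψ x y} (h : LRep I i t M φ x) (h' : LRep I i t M ψ y) :
    LRep I i t M (φ + ψ) (x + y) := by
  obtain ⟨z, hz, rfl⟩ := h
  obtain ⟨w, hw, rfl⟩ := h'
  exact ⟨z + w, hz.add _ _ _ hw, map_add _ _ _⟩

lemma LRep.smul (r : R) {φ x} (h : LRep I i t M φ x) : LRep I i t M (r • φ) (r • x) := by
  obtain ⟨z, hz, rfl⟩ := h
  exact ⟨r • z, hz.smul _ _ _ r, map_smul _ _ _⟩

lemma LRep.sub {φ ψ x y} (h : LRep I i t M φ x) (h' : LRep I i t M ψ y) :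
    LRep I i t M (φ - ψ) (x - y) := by
  have := h.add (h'.smul (-1))
  rwa [neg_one_smul, neg_one_smul, ← sub_eq_add_neg, ← sub_eq_add_neg] at this

lemma LRep.cocycle {φ x} (h : LRep I i t M φ x) : (PR I t).complex.d (i+1) i ≫ φ = 0 := by
  obtain ⟨z, hz, rfl⟩ := h
  exact hz.cocycle _ _ _

lemma LRep.of_cocycle {φ : (PR I t).complex.X i ⟶ M} (h : (PR I t).complex.d (i+1) i ≫ φ = 0) :
    ∃ x, LRep I i t M φ x := by
  obtain ⟨y, hy⟩ := ERep.of_cocycle _ _ _ h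
  exact ⟨_, y, hy, rfl⟩

lemma LRep.uniq {φ x y} (h : LRep I i t M φ x) (h' : LRep I i t M φ y) : x = y := by
  obtain ⟨z, hz, rfl⟩ := h
  obtain ⟨w, hw, rfl⟩ := h'
  rw [hz.uniq _ _ _ hw]

lemma LRep.mapY (g : M ⟶ N) {φ x} (h : LRep I i t M φ x) :
    LRep I i t N (φ ≫ g) (((localCohomology I i).map g).hom x) := by
  obtain ⟨z, hz, rfl⟩ := h
  exact ⟨_, hz.mapY _ _ _ g, lI_nat _ _ _ _ _⟩

lemma LRep.trans {φ x} (h : LRep I i t M φ x) {s : ℕ} (hs : t ≤ s) :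
    LRep I i s M ((kI I hs).f i ≫ φ) x := by
  obtain ⟨z, hz, rfl⟩ := h
  exact ⟨_, hz.mapX _ _ _ _ (qI I hs) (kI I hs) (kI_comm I hs), lI_trans _ _ _ _ _⟩

lemma LRep.of_boundary (χ : (PR I t).complex.X i ⟶ M) :
    LRep I (i+1) t M ((PR I t).complex.d (i+1) i ≫ χ) 0 :=
  ⟨0, ERep.of_boundary _ _ _ _, map_zero _⟩

lemma LRep.boundary {φ} (h : LRep I (i+1) t M φ 0) :
    ∃ (s : ℕ) (hs : t ≤ s) (χ : (PR I s).complex.X i ⟶ M),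
      (kI I hs).f (i+1) ≫ φ = (PR I s).complex.d (i+1) i ≫ χ := by
  obtain ⟨z, hz, hz0⟩ := h
  obtain ⟨s, hs, h0⟩ := lI_zero _ _ _ _ _ hz0
  have := hz.mapX _ _ _ (PR I s) (qI I hs) (kI I hs) (kI_comm I hs)
  rw [h0] at this
  obtain ⟨χ, hχ⟩ := this.boundary
  exact ⟨s, hs, χ, hχ⟩

lemma LRep.zero_zero {φ} (h : LRep I 0 t M φ 0) :
    ∃ (s : ℕ) (hs : t ≤ s), (kI I hs).f 0 ≫ φ = 0 := by
  obtain ⟨z, hz, hz0⟩ := h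
  obtain ⟨s, hs, h0⟩ := lI_zero _ _ _ _ _ hz0
  have := hz.mapX _ _ _ (PR I s) (qI I hs) (kI I hs) (kI_comm I hs)
  rw [h0] at this
  exact ⟨s, hs, this.zero_zero⟩

end LCRep

section Rel
variable {R X Y : Type*} [Ring R] [AddCommGroup X] [AddCommGroup Y] [Module R X] [Module R Y]

lemma exists_linear_of_rel (Γ : Submodule R (X × Y)) (tot : ∀ x, ∃ y, (x, y) ∈ Γ)
    (single : ∀ y, ((0 : X), y) ∈ Γ → y = 0) :
    ∃ f : X →ₗ[R] Y, ∀ x y, (x, y) ∈ Γ ↔ f x = y := by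
  choose f hf using tot
  have uq : ∀ x y, (x, y) ∈ Γ → f x = y := by
    intro x y h
    have := Γ.sub_mem (hf x) h
    simp only [Prod.mk_sub_mk, sub_self] at this
    exact sub_eq_zero.1 (single _ this)
  refine ⟨⟨⟨f, fun x y => uq _ _ ?_⟩, fun r x => uq _ _ ?_⟩, fun x y => ⟨uq x y, ?_⟩⟩
  · exact Γ.add_mem (hf x) (hf y)
  · exact Γ.smul_mem r (hf x)
  · rintro rfl; exact hf x

lemma exists_inj_of_rel (Γ : Submodule R (X × Y)) (N : Submodule R Y) (tot : ∀ x, ∃ y, (x, y) ∈ Γ)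
    (single : ∀ y, ((0 : X), y) ∈ Γ → y ∈ N) (inj : ∀ x y, (x, y) ∈ Γ → y ∈ N → x = 0) :
    ∃ f : X →ₗ[R] Y ⧸ N, Function.Injective f ∧ ∀ x y, (x, y) ∈ Γ → f x = N.mkQ y := by
  obtain ⟨f, hf⟩ := exists_linear_of_rel (Γ.map (LinearMap.prodMap LinearMap.id N.mkQ))
    (fun x => by
      obtain ⟨y, hy⟩ := tot x
      exact ⟨N.mkQ y, (x, y), hy, rfl⟩)
    (by
      rintro y ⟨⟨x, y'⟩, h, h'⟩
      simp only [LinearMap.prodMap_apply, LinearMap.id_coe, id_eq, Prod.mk.injEq] at h'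
      obtain ⟨rfl, rfl⟩ := h'
      simpa using single _ h)
  refine ⟨f, ?_, fun x y h => (hf _ _).1 ⟨(x, y), h, rfl⟩⟩
  rw [injective_iff_map_eq_zero]
  intro x hx
  obtain ⟨⟨x', y'⟩, h, h'⟩ := (hf x 0).2 hx
  simp only [LinearMap.prodMap_apply, LinearMap.id_coe, id_eq, Prod.mk.injEq] at h'
  obtain ⟨rfl, h'⟩ := h'
  exact inj _ _ h (by simpa using h')
end Rel
end
end LCF

namespace LCF
open CategoryTheory Limits Opposite
noncomputable section
section LCShift
variable {R : Type u} [CommRing R] {I : Ideal R}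

lemma ext_inj {X : ModuleCat.{u} R} (P : ProjectiveResolution X) (i : ℕ) {J : ModuleCat.{u} R}
    [Injective J] (φ : P.complex.X (i+1) ⟶ J) (h : P.complex.d (i+2) (i+1) ≫ φ = 0) :
    ∃ ψ : P.complex.X i ⟶ J, P.complex.d (i+1) i ≫ ψ = φ :=
  ⟨(P.exact_succ i).descToInjective φ h, (P.exact_succ i).comp_descToInjective φ h⟩

lemma LC_inj (i : ℕ) {J : ModuleCat.{u} R} [Injective J] (x : LC I (i+1) J) : x = 0 := by
  obtain ⟨t, φ, h⟩ := LRep.exists x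
  obtain ⟨ψ, rfl⟩ := ext_inj _ i φ h.cocycle
  exact h.uniq (LRep.of_boundary ψ)

variable {M J N : ModuleCat.{u} R} (f : M ⟶ J) (g : J ⟶ N) (w : f ≫ g = 0)

def shiftRel (I : Ideal R) (i : ℕ) : Submodule R (LC I (i+1) M × LC I i N) where
  carrier := {p | ∃ t, ∃ ψ : (PR I t).complex.X i ⟶ J, ∃ χ : (PR I t).complex.X (i+1) ⟶ M,
    χ ≫ f = (PR I t).complex.d (i+1) i ≫ ψ ∧ LRep I i t N (ψ ≫ g) p.2 ∧ LRep I (i+1) t M χ p.1}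
  zero_mem' := by
    obtain ⟨x, hx⟩ := LRep.of_cocycle (I := I) (i := i) (t := 0) (M := N) (φ := 0) (by simp)
    obtain ⟨y, hy⟩ := LRep.of_cocycle (I := I) (i := i+1) (t := 0) (M := M) (φ := 0) (by simp)
    have h1 := hx.smul 0
    have h2 := hy.smul 0
    rw [zero_smul, zero_smul] at h1 h2
    exact ⟨0, 0, 0, by simp, by simpa using h1, by simpa using h2⟩
  add_mem' := by
    rintro ⟨y, x⟩ ⟨y', x'⟩ ⟨t, ψ, χ, h1, h2, h3⟩ ⟨t', ψ', χ', h1', h2', h3'⟩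
    have e : t ≤ max t t' := le_max_left _ _
    have e' : t' ≤ max t t' := le_max_right _ _
    refine ⟨max t t', (kI I e).f i ≫ ψ + (kI I e').f i ≫ ψ',
      (kI I e).f (i+1) ≫ χ + (kI I e').f (i+1) ≫ χ', ?_, ?_, ?_⟩
    · simp [h1, h1']
    · have := (h2.trans e).add (h2'.trans e')
      simpa using this
    · exact (h3.trans e).add (h3'.trans e')
  smul_mem' := by
    rintro r ⟨y, x⟩ ⟨t, ψ, χ, h1, h2, h3⟩
    refine ⟨t, r • ψ, r • χ, by simp [h1], ?_, h3.smul r⟩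
    have := h2.smul r
    rwa [← Linear.smul_comp] at this

lemma shift_aux [Mono f] [Epi g] (hex : (ShortComplex.mk f g w).Exact) (i t : ℕ)
    (ψ ω : (PR I t).complex.X i ⟶ J) (χ : (PR I t).complex.X (i+1) ⟶ M)
    (h1 : χ ≫ f = (PR I t).complex.d (i+1) i ≫ ψ)
    (hω : (PR I t).complex.d (i+1) i ≫ ω = 0)
    (h2 : LRep I i t N ((ψ - ω) ≫ g) 0) {y} (h3 : LRep I (i+1) t M χ y) : y = 0 := by
  have hlift : ∀ {X : ModuleCat.{u} R} (τ : X ⟶ J), τ ≫ g = 0 → ∃ σ : X ⟶ M, σ ≫ f = τ :=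
    fun τ h => ⟨hex.lift τ h, hex.lift_f τ h⟩
  have key : ∃ (s : ℕ) (hs : t ≤ s) (σ : (PR I s).complex.X i ⟶ M),
      (PR I s).complex.d (i+1) i ≫ ((kI I hs).f i ≫ (ψ - ω) - σ ≫ f) = 0 := by
    cases i with
    | zero =>
      obtain ⟨s, hs, h5⟩ := h2.zero_zero
      rw [← Category.assoc] at h5
      obtain ⟨σ, hσ⟩ := hlift _ h5
      exact ⟨s, hs, σ, by rw [hσ, sub_self, comp_zero]⟩
    | succ i =>
      obtain ⟨s, hs, ρ, h5⟩ := h2.boundary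
      have h6 : ((kI I hs).f (i+1) ≫ (ψ - ω) -
          (PR I s).complex.d (i+1) i ≫ Projective.factorThru ρ g) ≫ g = 0 := by
        rw [Preadditive.sub_comp, Category.assoc, Category.assoc, h5, Projective.factorThru_comp,
          sub_self]
      obtain ⟨σ, hσ⟩ := hlift _ h6
      refine ⟨s, hs, σ, ?_⟩
      rw [hσ]
      simp
  obtain ⟨s, hs, σ, h4⟩ := key
  have h5 : (kI I hs).f (i+1) ≫ χ = (PR I s).complex.d (i+1) i ≫ σ := by
    rw [← cancel_mono f, Category.assoc, Category.assoc, h1]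
    rw [Preadditive.comp_sub, ← Category.assoc, ← (kI I hs).comm, Category.assoc,
      Preadditive.comp_sub, hω, sub_zero, sub_eq_zero] at h4
    exact h4
  have h6 := h3.trans hs
  rw [h5] at h6
  exact h6.uniq (LRep.of_boundary σ)

theorem LC_shift [Mono f] [Epi g] [Injective J] (hex : (ShortComplex.mk f g w).Exact) (i : ℕ) :
    ∃ F : LC I (i+1) M →ₗ[R] LC I i N ⧸ LinearMap.range ((localCohomology I i).map g).hom,
      Function.Injective F := by
  have H1 : ∀ y, ∃ x, (y, x) ∈ shiftRel f g I i := by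
    intro y
    obtain ⟨t, χ, h⟩ := LRep.exists y
    obtain ⟨ψ, hψ⟩ := ext_inj (PR I t) i (χ ≫ f) (by rw [← Category.assoc, h.cocycle, zero_comp])
    obtain ⟨x, hx⟩ := LRep.of_cocycle (I := I) (i := i) (t := t) (φ := ψ ≫ g) (by
      rw [← Category.assoc, hψ, Category.assoc, w, comp_zero])
    exact ⟨x, t, ψ, χ, hψ.symm, hx, h⟩
  have H2 : ∀ x, (0, x) ∈ shiftRel f g I i →
      x ∈ LinearMap.range ((localCohomology I i).map g).hom := by
    rintro x ⟨t, ψ, χ, h1, h2, h3⟩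
    obtain ⟨s, hs, χ', h4⟩ := h3.boundary
    have h5 := h2.trans hs
    obtain ⟨z, hz⟩ := LRep.of_cocycle (I := I) (i := i) (t := s)
      (φ := (kI I hs).f i ≫ ψ - χ' ≫ f) (by
      rw [Preadditive.comp_sub, ← Category.assoc, ← Category.assoc, ← h4, ← (kI I hs).comm,
        Category.assoc, Category.assoc, h1, sub_self])
    refine ⟨z, ?_⟩
    have h6 := hz.mapY g
    rw [Preadditive.sub_comp, Category.assoc, Category.assoc, w, comp_zero, sub_zero] at h6
    exact h6.uniq h5
  have H3 : ∀ y x, (y, x) ∈ shiftRel f g I i →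
      x ∈ LinearMap.range ((localCohomology I i).map g).hom → y = 0 := by
    rintro y x ⟨t, ψ, χ, h1, h2, h3⟩ ⟨w', rfl⟩
    obtain ⟨t', ω, hω⟩ := LRep.exists w'
    have e : t ≤ max t t' := le_max_left _ _
    have e' : t' ≤ max t t' := le_max_right _ _
    have h4 := (h2.trans e).sub ((hω.mapY g).trans e')
    simp only [sub_self] at h4
    refine shift_aux f g w hex i (max t t') ((kI I e).f i ≫ ψ) ((kI I e').f i ≫ ω)
      ((kI I e).f (i+1) ≫ χ) ?_ (hω.trans e').cocycle ?_ (h3.trans e)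
    · simp [h1]
    · simpa using h4
  obtain ⟨F, hF, -⟩ := exists_inj_of_rel (shiftRel f g I i)
    (LinearMap.range ((localCohomology I i).map g).hom) H1 H2 H3
  exact ⟨F, hF⟩

end LCShift
end
end LCF

namespace LCF
open CategoryTheory Limits Opposite
noncomputable section
section LCZero
variable {R : Type u} [CommRing R] (I : Ideal R)

def piI (t : ℕ) : (PR I t).complex.X 0 ⟶ QI I t := (PR I t).π.f 0

lemma piI_surj (t : ℕ) : Function.Surjective (piI I t).hom := by
  have : Epi (piI I t) := inferInstanceAs (Epi ((PR I t).π.f 0))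
  exact (ModuleCat.epi_iff_surjective _).1 this

lemma piI_ker (t : ℕ) (p : (PR I t).complex.X 0) (h : (piI I t).hom p = 0) :
    ∃ q, ((PR I t).complex.d 1 0).hom q = p :=
  (ShortComplex.moduleCat_exact_iff _).1 ((PR I t).exact₀) p h

lemma piI_d (t : ℕ) : (PR I t).complex.d 1 0 ≫ piI I t = 0 :=
  (PR I t).complex_d_comp_π_f_zero

def uI (t : ℕ) : QI I t := (Submodule.Quotient.mk 1 : R ⧸ I^t)

lemma qI_uI {t s : ℕ} (h : t ≤ s) : (qI I h).hom (uI I s) = uI I t := rfl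

lemma uI_gen (t : ℕ) (x : QI I t) : ∃ r : R, x = r • uI I t := by
  obtain ⟨r, hr⟩ := Submodule.Quotient.mk_surjective (I^t) x
  refine ⟨r, hr.symm.trans ?_⟩
  change _ = Submodule.Quotient.mk (r • 1)
  rw [smul_eq_mul, mul_one]

lemma uI_zero (t : ℕ) {r : R} (h : r ∈ I ^ t) : r • uI I t = 0 := by
  change (Submodule.Quotient.mk (r • 1) : R ⧸ I^t) = 0
  rw [smul_eq_mul, mul_one]
  exact (Submodule.Quotient.mk_eq_zero _).2 h

variable (M : ModuleCat.{u} R)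

variable {I M} in
lemma phi_uniq {t : ℕ} (φ : (PR I t).complex.X 0 ⟶ M) (hφ : (PR I t).complex.d 1 0 ≫ φ = 0)
    {p q} (h : (piI I t).hom p = (piI I t).hom q) : φ.hom p = φ.hom q := by
  obtain ⟨z, hz⟩ := piI_ker I t (p - q) (by rw [map_sub, h, sub_self])
  have : φ.hom (p - q) = 0 := by
    rw [← hz]; exact congrArg (fun f => f.hom z) hφ
  rwa [map_sub, sub_eq_zero] at this

variable {I M} in
lemma piI_k {t s : ℕ} (h : t ≤ s) (p) (hp : (piI I s).hom p = uI I s) :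
    (piI I t).hom (((kI I h).f 0).hom p) = uI I t := by
  have := congrArg (fun f => f.hom p) (kI_comm I h)
  refine Eq.trans this ?_
  refine Eq.trans (congrArg (qI I h).hom hp) (qI_uI I h)

def zetaRel : Submodule R (LC I 0 M × M) where
  carrier := {x | ∃ t, ∃ φ : (PR I t).complex.X 0 ⟶ M, ∃ p, LRep I 0 t M φ x.1 ∧
    (piI I t).hom p = uI I t ∧ φ.hom p = x.2}
  zero_mem' := by
    obtain ⟨x, hx⟩ := LRep.of_cocycle (I := I) (i := 0) (t := 0) (M := M) (φ := 0) (by simp)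
    have h1 := hx.smul 0
    rw [zero_smul, zero_smul] at h1
    obtain ⟨p, hp⟩ := piI_surj I 0 (uI I 0)
    exact ⟨0, 0, p, h1, hp, rfl⟩
  add_mem' := by
    rintro ⟨x, m⟩ ⟨x', m'⟩ ⟨t, φ, p, h1, h2, h3⟩ ⟨t', φ', p', h1', h2', h3'⟩
    have e : t ≤ max t t' := le_max_left _ _
    have e' : t' ≤ max t t' := le_max_right _ _
    obtain ⟨p'', hp''⟩ := piI_surj I (max t t') (uI I (max t t'))
    refine ⟨max t t', _, p'', (h1.trans e).add (h1'.trans e'), hp'', ?_⟩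
    simp only at h3 h3'
    rw [← h3, ← h3', ← phi_uniq φ h1.cocycle ((piI_k e p'' hp'').trans h2.symm),
      ← phi_uniq φ' h1'.cocycle ((piI_k e' p'' hp'').trans h2'.symm)]
    rfl
  smul_mem' := by
    rintro r ⟨x, m⟩ ⟨t, φ, p, h1, h2, h3⟩
    refine ⟨t, r • φ, p, h1.smul r, h2, ?_⟩
    simp only at h3
    rw [← h3]; rfl

theorem zeta_exists : ∃ f : LC I 0 M →ₗ[R] M, ∀ x m, (x, m) ∈ zetaRel I M ↔ f x = m := by
  apply exists_linear_of_rel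
  · intro x
    obtain ⟨t, φ, h⟩ := LRep.exists x
    obtain ⟨p, hp⟩ := piI_surj I t (uI I t)
    exact ⟨_, t, φ, p, h, hp, rfl⟩
  · rintro m ⟨t, φ, p, h1, h2, h3⟩
    obtain ⟨s, hs, h4⟩ := h1.zero_zero
    obtain ⟨p', hp'⟩ := piI_surj I s (uI I s)
    simp only at h3
    rw [← h3, ← phi_uniq φ h1.cocycle ((piI_k hs p' hp').trans h2.symm)]
    exact congrArg (fun f => f.hom p') h4

def zeta : LC I 0 M →ₗ[R] M := (zeta_exists I M).choose

lemma zeta_spec (x m) : (x, m) ∈ zetaRel I M ↔ zeta I M x = m := (zeta_exists I M).choose_spec x m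

theorem zeta_inj : Function.Injective (zeta I M) := by
  rw [injective_iff_map_eq_zero]
  intro x hx
  obtain ⟨t, φ, p, h1, h2, h3⟩ := (zeta_spec I M x 0).2 hx
  have : φ = 0 := by
    ext q
    obtain ⟨r, hr⟩ := uI_gen I t ((piI I t).hom q)
    have h4 := phi_uniq φ h1.cocycle (p := q) (q := r • p) (by rw [hr, map_smul, h2])
    refine h4.trans ?_
    simp only at h3
    rw [map_smul, h3, smul_zero]; rfl
  subst this
  have h5 := h1.smul 0
  rw [zero_smul, zero_smul] at h5
  exact h1.uniq h5

theorem zeta_mem (x) : ∃ t, ∀ r ∈ I ^ t, r • zeta I M x = 0 := by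
  obtain ⟨t, φ, p, h1, h2, h3⟩ := (zeta_spec I M x _).2 rfl
  refine ⟨t, fun r hr => ?_⟩
  simp only at h3
  rw [← h3, ← map_smul]
  have h4 := phi_uniq φ h1.cocycle (p := r • p) (q := 0) (by
    rw [map_smul, h2, uI_zero I t hr, map_zero])
  rw [h4, map_zero]

theorem zeta_surj (m : M) (t : ℕ) (h : ∀ r ∈ I ^ t, r • m = 0) : ∃ x, zeta I M x = m := by
  let g : QI I t ⟶ M := ModuleCat.ofHom (Submodule.liftQ (I^t) (LinearMap.toSpanSingleton R M m)
    (fun r hr => h r hr))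
  obtain ⟨x, hx⟩ := LRep.of_cocycle (I := I) (i := 0) (t := t) (M := M) (φ := piI I t ≫ g)
    (by rw [← Category.assoc, piI_d, zero_comp])
  obtain ⟨p, hp⟩ := piI_surj I t (uI I t)
  refine ⟨x, (zeta_spec I M x m).1 ⟨t, _, p, hx, hp, ?_⟩⟩
  change g.hom ((piI I t).hom p) = m
  rw [hp]
  exact one_smul R m

theorem zeta_nat {N : ModuleCat.{u} R} (g : M ⟶ N) (x) :
    zeta I N (((localCohomology I 0).map g).hom x) = g.hom (zeta I M x) := by
  obtain ⟨t, φ, p, h1, h2, h3⟩ := (zeta_spec I M x _).2 rfl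
  rw [← zeta_spec]
  refine ⟨t, _, p, h1.mapY g, h2, ?_⟩
  simp only at h3
  rw [← h3]; rfl
end LCZero
end
end LCF

namespace LCF
noncomputable section

section DStrDef
variable (A : Type u) [CommRing A] (n : ℕ) (M : Type u) [AddCommGroup M] [Module A M]
  [Module (MvPolynomial (Fin n) A) M]

/-- Divided power differential operators acting on a module over a polynomial ring. -/
structure DStr where
  d : (Fin n →₀ ℕ) → M →ₗ[A] M
  d_zero : d 0 = LinearMap.id
  d_succ : ∀ β j m, d (β + Finsupp.single j 1) ((MvPolynomial.X j : MvPolynomial (Fin n) A) • m) =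
    (MvPolynomial.X j : MvPolynomial (Fin n) A) • d (β + Finsupp.single j 1) m + d β m
  d_comm : ∀ β j m, β j = 0 → d β ((MvPolynomial.X j : MvPolynomial (Fin n) A) • m) =
    (MvPolynomial.X j : MvPolynomial (Fin n) A) • d β m
end DStrDef

/-- Taylor expansion. -/
def tay (A : Type u) [CommRing A] (n : ℕ) :
    MvPolynomial (Fin n) A →ₐ[A] MvPowerSeries (Fin n) (MvPolynomial (Fin n) A) :=
  MvPolynomial.aeval (fun j => MvPowerSeries.C (MvPolynomial.X j) + MvPowerSeries.X j)

lemma tay_X (A : Type u) [CommRing A] (n : ℕ) (j) :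
    tay A n (MvPolynomial.X j) = MvPowerSeries.C (MvPolynomial.X j) + MvPowerSeries.X j := by
  simp [tay]

lemma tay_C (A : Type u) [CommRing A] (n : ℕ) (a : A) :
    tay A n (MvPolynomial.C a) = MvPowerSeries.C (MvPolynomial.C a) := by
  rw [tay, MvPolynomial.aeval_C]
  ext β
  rw [MvPowerSeries.algebraMap_apply]; rfl

section Leibniz
variable {A : Type u} [CommRing A] {n : ℕ} {M : Type u} [AddCommGroup M] [Module A M]
  [Module (MvPolynomial (Fin n) A) M] [IsScalarTower A (MvPolynomial (Fin n) A) M]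

lemma coeff_X_mul_of {S : Type*} [Semiring S] (β : Fin n →₀ ℕ) (j : Fin n)
    (φ : MvPowerSeries (Fin n) S) (h : β j = 0) :
    MvPowerSeries.coeff β (MvPowerSeries.X j * φ) = 0 := by
  classical
  rw [MvPowerSeries.X_def, MvPowerSeries.coeff_monomial_mul, if_neg]
  rw [Finsupp.single_le_iff]; omega

lemma coeff_X_mul_add {S : Type*} [Semiring S] (β : Fin n →₀ ℕ) (j : Fin n)
    (φ : MvPowerSeries (Fin n) S) :
    MvPowerSeries.coeff (β + Finsupp.single j 1) (MvPowerSeries.X j * φ) =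
      MvPowerSeries.coeff β φ := by
  rw [add_comm, MvPowerSeries.X_def, MvPowerSeries.coeff_add_monomial_mul, one_mul]

lemma finsupp_cases (β : Fin n →₀ ℕ) (j : Fin n) :
    β j = 0 ∨ ∃ γ, β = γ + Finsupp.single j 1 := by
  rcases Nat.eq_zero_or_pos (β j) with h | h
  · exact Or.inl h
  · exact Or.inr ⟨β - Finsupp.single j 1, (tsub_add_cancel_of_le
      (by rw [Finsupp.single_le_iff]; omega)).symm⟩

def DStr.ser (D : DStr A n M) : MvPowerSeries (Fin n) (Module.End A M) := fun β => D.d β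

lemma DStr.coeff_ser (D : DStr A n M) (β) : MvPowerSeries.coeff β D.ser = D.d β := rfl

def act (A : Type u) [CommRing A] (n : ℕ) (M : Type u) [AddCommGroup M] [Module A M]
  [Module (MvPolynomial (Fin n) A) M] [IsScalarTower A (MvPolynomial (Fin n) A) M] :
  MvPolynomial (Fin n) A →+* Module.End A M := (Algebra.lsmul A A M).toRingHom

lemma act_apply (p : MvPolynomial (Fin n) A) (m : M) : act A n M p m = p • m := rfl

lemma DStr.ser_leibniz (D : DStr A n M) (p : MvPolynomial (Fin n) A) :
    D.ser * MvPowerSeries.C (act A n M p) =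
      MvPowerSeries.map (act A n M) (tay A n p) * D.ser := by
  induction p using MvPolynomial.induction_on with
  | C a =>
    rw [tay_C, MvPowerSeries.map_C]
    ext β m
    rw [MvPowerSeries.coeff_mul_C, MvPowerSeries.coeff_C_mul]
    simp only [D.coeff_ser, Module.End.mul_apply, act_apply]
    have : ∀ m : M, (MvPolynomial.C a : MvPolynomial (Fin n) A) • m = a • m := fun m => by
      rw [← algebraMap_smul (MvPolynomial (Fin n) A) a m]; rfl
    rw [this, this, map_smul]
  | add p q hp hq => rw [map_add, map_add, map_add, map_add, mul_add, add_mul, hp, hq]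
  | mul_X p j hp =>
    have hX : D.ser * MvPowerSeries.C (act A n M (MvPolynomial.X j)) =
        MvPowerSeries.map (act A n M) (tay A n (MvPolynomial.X j)) * D.ser := by
      rw [tay_X, map_add, MvPowerSeries.map_C, MvPowerSeries.map_X, add_mul]
      ext β m
      rw [map_add, MvPowerSeries.coeff_mul_C, MvPowerSeries.coeff_C_mul]
      rcases finsupp_cases β j with h | ⟨γ, rfl⟩
      · rw [coeff_X_mul_of β j _ h]
        simp only [D.coeff_ser, Module.End.mul_apply, act_apply, add_zero]
        exact D.d_comm β j m h
      · rw [coeff_X_mul_add]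
        simp only [D.coeff_ser, Module.End.mul_apply, act_apply, LinearMap.add_apply]
        exact D.d_succ γ j m
    rw [map_mul, map_mul, ← mul_assoc, hp, mul_assoc, hX, ← mul_assoc, ← map_mul, ← map_mul]

open Finset in
lemma DStr.leibniz (D : DStr A n M) (p : MvPolynomial (Fin n) A) (β : Fin n →₀ ℕ) (m : M) :
    D.d β (p • m) = ∑ q ∈ antidiagonal β, MvPowerSeries.coeff q.1 (tay A n p) • D.d q.2 m := by
  classical
  have h := congrArg (fun s : MvPowerSeries (Fin n) (Module.End A M) => MvPowerSeries.coeff β s m) (D.ser_leibniz p)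
  rw [MvPowerSeries.coeff_mul_C, MvPowerSeries.coeff_mul, LinearMap.sum_apply] at h
  exact h

lemma tay_coeff_zero (p : MvPolynomial (Fin n) A) : MvPowerSeries.coeff 0 (tay A n p) = p := by
  induction p using MvPolynomial.induction_on with
  | C a => rw [tay_C]; simp
  | add p q hp hq => rw [map_add, map_add, hp, hq]
  | mul_X p j hp =>
    rw [map_mul, tay_X, MvPowerSeries.coeff_zero_eq_constantCoeff_apply, map_mul,
      ← MvPowerSeries.coeff_zero_eq_constantCoeff_apply, hp]
    simp

lemma finsupp_ind {P : (Fin n →₀ ℕ) → Prop} (h0 : P 0)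
    (h1 : ∀ β j, P β → P (β + Finsupp.single j 1)) (β) : P β := by
  have key : ∀ k : ℕ, ∀ β : Fin n →₀ ℕ, β.degree = k → P β := by
    intro k
    induction k with
    | zero =>
      intro β hβ
      rw [Finsupp.degree_eq_zero_iff] at hβ
      rwa [hβ]
    | succ k ih =>
      intro β hβ
      have : ∃ j, β j ≠ 0 := by
        by_contra hcon
        push Not at hcon
        have : β = 0 := Finsupp.ext hcon
        rw [this, map_zero] at hβ
        omega
      obtain ⟨j, hj⟩ := this
      rcases finsupp_cases β j with h | ⟨γ, rfl⟩
      · exact absurd h hj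
      · apply h1
        apply ih
        rw [map_add, Finsupp.degree_single] at hβ
        omega
  exact key _ β rfl

/-- the coefficients of the Taylor expansion of a monomial -/
lemma tay_monomial_coeff (α : Fin n →₀ ℕ) : ∀ γ : Fin n →₀ ℕ, ∃ c : A,
    (¬ γ ≤ α → MvPowerSeries.coeff γ (tay A n (MvPolynomial.monomial α 1)) = 0) ∧
    (γ ≤ α → MvPowerSeries.coeff γ (tay A n (MvPolynomial.monomial α 1)) =
      MvPolynomial.monomial (α - γ) c) ∧ (γ = α → c = 1) := by
  classical
  induction α using finsupp_ind with
  | h0 =>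
    intro γ
    refine ⟨1, ?_, ?_, fun _ => rfl⟩
    · intro h
      have h' : γ ≠ 0 := fun h' => h h'.le
      change MvPowerSeries.coeff γ (tay A n 1) = 0
      rw [map_one, MvPowerSeries.coeff_one, if_neg h']
    · intro h
      have h' : γ = 0 := nonpos_iff_eq_zero.1 h
      subst h'
      rw [tay_coeff_zero]; simp
  | h1 α j ih =>
    intro γ
    have e1 : (MvPolynomial.monomial (α + Finsupp.single j 1) (1 : A)) =
      MvPolynomial.monomial α 1 * MvPolynomial.X j := by
      rw [MvPolynomial.X, MvPolynomial.monomial_mul, mul_one]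
    have e2 : MvPowerSeries.coeff γ (tay A n (MvPolynomial.monomial (α + Finsupp.single j 1) 1)) =
      MvPowerSeries.coeff γ (tay A n (MvPolynomial.monomial α 1)) * MvPolynomial.X j +
      MvPowerSeries.coeff γ (MvPowerSeries.X j * tay A n (MvPolynomial.monomial α 1)) := by
      rw [e1, map_mul, tay_X, mul_add, map_add, MvPowerSeries.coeff_mul_C, mul_comm (MvPowerSeries.X j)]
    rw [e2]
    obtain ⟨c, hc1, hc2, hc3⟩ := ih γ
    rcases finsupp_cases γ j with h | ⟨γ', rfl⟩
    · rw [coeff_X_mul_of γ j _ h, add_zero]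
      have hiff : γ ≤ α + Finsupp.single j 1 ↔ γ ≤ α := by
        constructor
        · intro hle k
          have := hle k
          by_cases hk : k = j
          · subst hk; rw [h]; exact Nat.zero_le _
          · rw [Finsupp.add_apply, Finsupp.single_eq_of_ne hk] at this
            exact this
        · intro hle; exact hle.trans (le_add_of_nonneg_right zero_le)
      refine ⟨c, ?_, ?_, ?_⟩
      · intro h'; rw [hc1 (fun h'' => h' (hiff.2 h'')), zero_mul]
      · intro h'
        have h'' := hiff.1 h'
        rw [hc2 h'', MvPolynomial.X, MvPolynomial.monomial_mul, mul_one, ← tsub_add_eq_add_tsub h'']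
      · rintro rfl; simp at h
    · rw [coeff_X_mul_add]
      have hiff : γ' + Finsupp.single j 1 ≤ α + Finsupp.single j 1 ↔ γ' ≤ α :=
        add_le_add_iff_right _
      obtain ⟨c', hc1', hc2', hc3'⟩ := ih γ'
      by_cases hle : γ' + Finsupp.single j 1 ≤ α
      · refine ⟨c + c', ?_, ?_, ?_⟩
        · intro h; exact absurd (hle.trans (le_add_of_nonneg_right zero_le)) h
        · intro h
          rw [hc2 hle, hc2' (hiff.1 h), MvPolynomial.X, MvPolynomial.monomial_mul, mul_one,
            add_tsub_add_eq_tsub_right, map_add]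
          have h3 : α - (γ' + Finsupp.single j 1) + Finsupp.single j 1 = α - γ' := by
            rw [← tsub_tsub]
            apply tsub_add_cancel_of_le
            rw [le_tsub_iff_left ((le_add_of_nonneg_right zero_le).trans hle)]
            exact hle
          rw [h3]
        · intro h
          rw [h] at hle
          exact absurd (hle j) (by simp)
      · refine ⟨c', ?_, ?_, ?_⟩
        · intro h
          rw [hc1 hle, hc1' (fun h' => h (hiff.2 h')), zero_mul, add_zero]
        · intro h
          rw [hc1 hle, hc2' (hiff.1 h), zero_mul, zero_add, add_tsub_add_eq_tsub_right]
        · intro h; exact hc3' (add_right_cancel h)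

end Leibniz
end
end LCF

namespace LCF
noncomputable section

section FiltSec
variable {A : Type u} [CommRing A] {n : ℕ} {M : Type u} [AddCommGroup M] [Module A M]
  [Module (MvPolynomial (Fin n) A) M] [IsScalarTower A (MvPolynomial (Fin n) A) M]
  {N : Type u} [AddCommGroup N] [Module A N]
  [Module (MvPolynomial (Fin n) A) N] [IsScalarTower A (MvPolynomial (Fin n) A) N]

/-- A filtration compatible with the differential operators. -/
structure Filt (D : DStr A n M) where
  F : ℕ → Submodule A M
  mono : Monotone F
  X_mem : ∀ i j m, m ∈ F i → (MvPolynomial.X j : MvPolynomial (Fin n) A) • m ∈ F (i + 1)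
  d_mem : ∀ i β m, m ∈ F i → D.d β m ∈ F (i + β.degree)
  ex : ∀ m, ∃ i, m ∈ F i

lemma DStr.exists_quot (D : DStr A n M) (g : M →ₗ[MvPolynomial (Fin n) A] N)
    (hg : Function.Surjective g) (h : ∀ β m, g m = 0 → g (D.d β m) = 0) :
    ∃ D' : DStr A n N, ∀ β m, D'.d β (g m) = g (D.d β m) := by
  have hwd : ∀ β m m', g m = g m' → g (D.d β m) = g (D.d β m') := by
    intro β m m' e
    rw [← sub_eq_zero, ← map_sub, ← map_sub]
    apply h; rw [map_sub, e, sub_self]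
  have hs := Function.surjInv_eq hg
  let d' : (Fin n →₀ ℕ) → N →ₗ[A] N := fun β =>
    { toFun := fun y => g (D.d β (Function.surjInv hg y))
      map_add' := by
        intro x y
        rw [← map_add, ← map_add]
        apply hwd; rw [map_add, hs, hs, hs]
      map_smul' := by
        intro a x
        have : a • g (D.d β (Function.surjInv hg x)) =
          g (D.d β (a • Function.surjInv hg x)) := by
            rw [map_smul, LinearMap.map_smul_of_tower]
        rw [RingHom.id_apply, this]
        apply hwd; rw [hs, LinearMap.map_smul_of_tower, hs] }
  have hd' : ∀ β m, d' β (g m) = g (D.d β m) := fun β m => hwd _ _ _ (hs _)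
  refine ⟨⟨d', ?_, ?_, ?_⟩, hd'⟩
  · ext y
    obtain ⟨m, rfl⟩ := hg y
    rw [hd', D.d_zero]; rfl
  · intro β j y
    obtain ⟨m, rfl⟩ := hg y
    rw [← map_smul, hd', hd', hd', D.d_succ, map_add, map_smul]
  · intro β j y hβ
    obtain ⟨m, rfl⟩ := hg y
    rw [← map_smul, hd', hd', D.d_comm _ _ _ hβ, map_smul]

lemma DStr.exists_sub (D : DStr A n M) (ι : N →ₗ[MvPolynomial (Fin n) A] M)
    (hι : Function.Injective ι) (h : ∀ β x, ∃ y, ι y = D.d β (ι x)) :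
    ∃ D' : DStr A n N, ∀ β x, ι (D'.d β x) = D.d β (ι x) := by
  choose f hf using h
  let d' : (Fin n →₀ ℕ) → N →ₗ[A] N := fun β =>
    { toFun := f β
      map_add' := by
        intro x y
        apply hι
        rw [map_add, hf, hf, hf, map_add, map_add]
      map_smul' := by
        intro a x
        apply hι
        rw [hf, RingHom.id_apply, ← LinearMap.coe_restrictScalars A ι, map_smul, map_smul, map_smul,
          LinearMap.coe_restrictScalars, hf] }
  have hd' : ∀ β x, ι (d' β x) = D.d β (ι x) := hf
  refine ⟨⟨d', ?_, ?_, ?_⟩, hd'⟩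
  · ext y
    apply hι
    rw [hd', D.d_zero]; rfl
  · intro β j y
    apply hι
    rw [map_add, ι.map_smul, hd', hd', hd', ι.map_smul, D.d_succ]
  · intro β j y hβ
    apply hι
    rw [ι.map_smul, hd', hd', ι.map_smul, D.d_comm _ _ _ hβ]

/-- image filtration -/
def Filt.quot {D : DStr A n M} (F : Filt D) (g : M →ₗ[MvPolynomial (Fin n) A] N)
    (hg : Function.Surjective g) (D' : DStr A n N) (h : ∀ β m, D'.d β (g m) = g (D.d β m)) :
    Filt D' where
  F i := (F.F i).map (g.restrictScalars A)
  mono := fun i j hij => Submodule.map_mono (F.mono hij)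
  X_mem := by
    rintro i j _ ⟨m, hm, rfl⟩
    exact ⟨_, F.X_mem i j m hm, by simp⟩
  d_mem := by
    rintro i β _ ⟨m, hm, rfl⟩
    exact ⟨_, F.d_mem i β m hm, (h β m).symm⟩
  ex := by
    intro y
    obtain ⟨m, rfl⟩ := hg y
    obtain ⟨i, hi⟩ := F.ex m
    exact ⟨i, m, hi, rfl⟩

/-- induced filtration -/
def Filt.sub {D : DStr A n M} (F : Filt D) (ι : N →ₗ[MvPolynomial (Fin n) A] M)
    (D' : DStr A n N) (h : ∀ β x, ι (D'.d β x) = D.d β (ι x)) :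
    Filt D' where
  F i := (F.F i).comap (ι.restrictScalars A)
  mono := fun i j hij => Submodule.comap_mono (F.mono hij)
  X_mem := by
    intro i j m hm
    have := F.X_mem i j _ hm
    simpa using this
  d_mem := by
    intro i β m hm
    have := F.d_mem i β _ hm
    rw [Submodule.mem_comap]
    simpa [h] using this
  ex := fun m => F.ex (ι m)

/-- shifted filtration -/
def Filt.shift {D : DStr A n M} (F : Filt D) (k : ℕ) : Filt D where
  F i := F.F (i + k)
  mono := fun i j hij => F.mono (by omega)
  X_mem := by
    intro i j m hm
    have := F.X_mem _ j _ hm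
    rwa [show i + 1 + k = i + k + 1 by omega]
  d_mem := by
    intro i β m hm
    have := F.d_mem _ β _ hm
    rwa [show i + β.degree + k = i + k + β.degree by omega]
  ex := fun m => by
    obtain ⟨i, hi⟩ := F.ex m
    exact ⟨i, F.mono (by omega) hi⟩

/-- torsion with respect to an ideal -/
def tors (P : Ideal (MvPolynomial (Fin n) A)) (M : Type u) [AddCommGroup M]
    [Module (MvPolynomial (Fin n) A) M] : Submodule (MvPolynomial (Fin n) A) M where
  carrier := {m | ∃ k, ∀ r ∈ P ^ k, r • m = 0}
  add_mem' := by
    rintro a b ⟨k, hk⟩ ⟨l, hl⟩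
    refine ⟨k + l, fun r hr => ?_⟩
    rw [smul_add, hk r (Ideal.pow_le_pow_right (by omega) hr),
      hl r (Ideal.pow_le_pow_right (by omega) hr), add_zero]
  zero_mem' := ⟨0, fun r _ => smul_zero _⟩
  smul_mem' := by
    rintro c a ⟨k, hk⟩
    refine ⟨k, fun r hr => ?_⟩
    rw [smul_comm, hk r hr, smul_zero]

lemma pow_succ_kill (P : Ideal (MvPolynomial (Fin n) A)) (k : ℕ) (m : M)
    (h : ∀ p ∈ P, ∀ r ∈ P ^ k, r • p • m = 0) : ∀ r ∈ P ^ (k + 1), r • m = 0 := by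
  intro r hr
  rw [pow_succ] at hr
  induction hr using Submodule.mul_induction_on' with
  | mem_mul_mem a ha b hb => rw [mul_smul]; exact h b hb a ha
  | add x _ y _ hx hy => rw [add_smul, hx, hy, add_zero]

open Finset in
lemma DStr.tors_aux (D : DStr A n M) (P : Ideal (MvPolynomial (Fin n) A)) :
    ∀ b k : ℕ, ∀ β : Fin n →₀ ℕ, β.degree = b → ∀ m : M, (∀ r ∈ P ^ k, r • m = 0) →
      ∀ r ∈ P ^ (k + b), r • D.d β m = 0 := by
  classical
  intro b
  induction b using Nat.strong_induction_on with
  | _ b ihb =>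
  intro k
  induction k with
  | zero =>
    intro β hβ m hm r _
    have : m = 0 := by simpa using hm 1 (by simp)
    rw [this, map_zero, smul_zero]
  | succ k ihk =>
    intro β hβ m hm
    rw [show k + 1 + b = (k + b) + 1 by omega]
    apply pow_succ_kill
    intro p hp r hr
    have h1 : r • D.d β (p • m) = 0 := by
      apply ihk β hβ (p • m) _ r hr
      intro r' hr'
      rw [← mul_smul]
      exact hm _ (by rw [pow_succ]; exact Ideal.mul_mem_mul hr' hp)
    have hmem : ((0 : Fin n →₀ ℕ), β) ∈ antidiagonal β := by simp
    rw [D.leibniz, ← Finset.add_sum_erase _ _ hmem, tay_coeff_zero, smul_add, smul_sum] at h1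
    rw [Finset.sum_eq_zero, add_zero] at h1
    · exact h1
    · rintro ⟨q1, q2⟩ hq
      rw [mem_erase, HasAntidiagonal.mem_antidiagonal] at hq
      obtain ⟨hne, hq⟩ := hq
      dsimp only at hq ⊢
      have hdeg : q1.degree + q2.degree = b := by rw [← map_add, hq, hβ]
      have hq1 : q1.degree ≠ 0 := by
        rw [Ne, Finsupp.degree_eq_zero_iff]
        rintro rfl
        rw [zero_add] at hq
        exact hne (by rw [hq])
      rw [smul_comm]
      rw [ihb q2.degree (by omega) (k+1) q2 rfl m hm r, smul_zero]
      exact Ideal.pow_le_pow_right (by omega) hr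

lemma DStr.tors_stable (D : DStr A n M) (P : Ideal (MvPolynomial (Fin n) A)) (β) (m : M)
    (hm : m ∈ tors P M) : D.d β m ∈ tors P M := by
  obtain ⟨k, hk⟩ := hm
  exact ⟨_, D.tors_aux P _ k β rfl m hk⟩

end FiltSec
end
end LCF

namespace LCF
noncomputable section

section Joseph
variable {A : Type u} [CommRing A] {n : ℕ} {M : Type u} [AddCommGroup M] [Module A M]
  [Module (MvPolynomial (Fin n) A) M] [IsScalarTower A (MvPolynomial (Fin n) A) M]

open Classical in
/-- shifted operators -/
def DStr.dsub (D : DStr A n M) (β γ : Fin n →₀ ℕ) : M →ₗ[A] M :=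
  if γ ≤ β then D.d (β - γ) else 0

lemma DStr.dsub_X (D : DStr A n M) (β γ : Fin n →₀ ℕ) (k : Fin n) (m : M) :
    D.dsub β γ ((MvPolynomial.X k : MvPolynomial (Fin n) A) • m) =
      (MvPolynomial.X k : MvPolynomial (Fin n) A) • D.dsub β γ m +
        D.dsub β (γ + Finsupp.single k 1) m := by
  classical
  unfold DStr.dsub
  by_cases h : γ ≤ β
  · rw [if_pos h]
    obtain ⟨δ, rfl⟩ := exists_add_of_le h
    rw [add_tsub_cancel_left]
    rcases finsupp_cases δ k with h0 | ⟨δ', rfl⟩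
    · rw [if_neg, D.d_comm _ _ _ h0]
      · simp
      · intro hle
        have := hle k
        simp [h0] at this
    · rw [if_pos, D.d_succ]
      · congr 3
        rw [add_comm δ', ← add_assoc, add_tsub_cancel_left]
      · rw [add_comm δ', ← add_assoc]; exact le_self_add
  · rw [if_neg h, if_neg]
    · simp
    · intro h'; exact h (le_self_add.trans h')

lemma Filt.stage1 {D : DStr A n M} (F : Filt D) {κ : Type} [Fintype κ]
    (em : κ → (Fin n →₀ ℕ)) (f : κ → MvPolynomial (Fin n) A) (i : ℕ)
    (h : ∀ m ∈ F.F i, ∑ b, f b • D.d (em b) m = 0) (γ : Fin n →₀ ℕ) :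
    ∀ j, j + γ.degree ≤ i → ∀ m ∈ F.F j, ∑ b, f b • D.dsub (em b) γ m = 0 := by
  induction γ using finsupp_ind with
  | h0 =>
    intro j hj m hm
    rw [← h m (F.mono (by omega) hm)]
    apply Finset.sum_congr rfl
    intro b _
    simp [DStr.dsub]
  | h1 γ k ih =>
    intro j hj m hm
    rw [map_add, Finsupp.degree_single] at hj
    have h1 := ih (j + 1) (by omega) _ (F.X_mem j k m hm)
    have h2 := ih j (by omega) m hm
    simp only [D.dsub_X, smul_add, Finset.sum_add_distrib] at h1
    rw [← h1]
    have h3 : ∑ x, f x • (MvPolynomial.X k : MvPolynomial (Fin n) A) • D.dsub (em x) γ m = 0 := by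
      simp only [smul_comm _ (MvPolynomial.X k : MvPolynomial (Fin n) A)]
      rw [← Finset.smul_sum, h2, smul_zero]
    rw [h3, zero_add]

open Finset in
lemma Filt.stage2 {D : DStr A n M} (F : Filt D) (f : MvPolynomial (Fin n) A) (i : ℕ)
    (h : ∀ m ∈ F.F i, f • m = 0) : ∀ (g : ℕ) (γ : Fin n →₀ ℕ), γ.degree = g →
    ∀ j, j + g ≤ i → ∀ m ∈ F.F j, MvPowerSeries.coeff γ (tay A n f) • m = 0 := by
  classical
  intro g
  induction g using Nat.strong_induction_on with
  | _ g ih =>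
  intro γ hγ j hj m hm
  have h1 : D.d γ (f • m) = 0 := by rw [h m (F.mono (by omega) hm), map_zero]
  have hmem : (γ, (0 : Fin n →₀ ℕ)) ∈ antidiagonal γ := by simp
  rw [D.leibniz, ← Finset.add_sum_erase _ _ hmem, D.d_zero, Finset.sum_eq_zero, add_zero] at h1
  · exact h1
  · rintro ⟨q1, q2⟩ hq
    rw [mem_erase, HasAntidiagonal.mem_antidiagonal] at hq
    obtain ⟨hne, hq⟩ := hq
    dsimp only at hq ⊢
    have hdeg : q1.degree + q2.degree = g := by rw [← map_add, hq, hγ]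
    have hq1 : q2.degree ≠ 0 := by
      rw [Ne, Finsupp.degree_eq_zero_iff]
      rintro rfl
      rw [add_zero] at hq
      exact hne (by rw [hq])
    exact ih q1.degree (by omega) q1 rfl (j + q2.degree) (by omega) _ (F.d_mem j q2 m hm)

lemma degree_lt_of_le_ne {a b : Fin n →₀ ℕ} (h : a ≤ b) (hne : a ≠ b) : a.degree < b.degree := by
  obtain ⟨c, rfl⟩ := exists_add_of_le h
  rw [map_add]
  have : c.degree ≠ 0 := by
    rw [Ne, Finsupp.degree_eq_zero_iff]
    rintro rfl
    simp at hne
  omega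

lemma monomial_smul_eq (α : Fin n →₀ ℕ) (c : A) (m : M) :
    (MvPolynomial.monomial α c : MvPolynomial (Fin n) A) • m =
      c • (MvPolynomial.monomial α 1 : MvPolynomial (Fin n) A) • m := by
  rw [← smul_assoc, MvPolynomial.smul_monomial, smul_eq_mul, mul_one]

lemma Filt.joseph {D : DStr A n M} (F : Filt D) (𝔪 : Ideal A) (hm : 𝔪.IsMaximal)
    (hkill : ∀ a ∈ 𝔪, ∀ m : M, a • m = 0) (hF0 : ∃ v ∈ F.F 0, v ≠ 0)
    {κ : Type} [Fintype κ]
    (em : κ → (Fin n →₀ ℕ)) (hem : Function.Injective em) (i : ℕ)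
    (hi : ∀ a b, (em a).degree + (em b).degree ≤ i) (c : κ → κ → A)
    (h : ∀ m ∈ F.F i, ∑ b, (∑ a, MvPolynomial.monomial (em a) (c a b)) • D.d (em b) m = 0) :
    ∀ a b, c a b ∈ 𝔪 := by
  classical
  by_contra hcon
  push Not at hcon
  obtain ⟨a0, b0, h0⟩ := hcon
  -- choose b of maximal degree
  obtain ⟨b, hb, hbmax⟩ := Finset.exists_max_image
    (Finset.univ.filter (fun b => ∃ a, c a b ∉ 𝔪)) (fun b => (em b).degree)
    ⟨b0, by simp only [Finset.mem_filter, Finset.mem_univ, true_and]; exact ⟨a0, h0⟩⟩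
  simp only [Finset.mem_filter, Finset.mem_univ, true_and] at hb hbmax
  obtain ⟨a1, ha1⟩ := hb
  set f := ∑ a, MvPolynomial.monomial (em a) (c a b) with hf
  have hfk : ∀ m ∈ F.F (i - (em b).degree), f • m = 0 := by
    intro m hm'
    have := F.stage1 em (fun b => ∑ a, MvPolynomial.monomial (em a) (c a b)) i h (em b)
      (i - (em b).degree) (by have := hi b b; omega) m hm'
    rw [Finset.sum_eq_single b] at this
    · simpa [DStr.dsub, D.d_zero] using this
    · intro b' _ hne
      by_cases hle : em b ≤ em b'
      · have hlt := degree_lt_of_le_ne hle (fun e => hne (hem e).symm)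
        rw [Finset.sum_smul]
        apply Finset.sum_eq_zero
        intro a _
        rw [monomial_smul_eq]
        apply hkill
        by_contra hc
        exact absurd (hbmax b' ⟨a, hc⟩) (by omega)
      · rw [DStr.dsub, if_neg hle]; simp
    · simp
  obtain ⟨a, ha, hamax⟩ := Finset.exists_max_image
    (Finset.univ.filter (fun a => c a b ∉ 𝔪)) (fun a => (em a).degree)
    ⟨a1, by simp only [Finset.mem_filter, Finset.mem_univ, true_and]; exact ha1⟩
  simp only [Finset.mem_filter, Finset.mem_univ, true_and] at ha hamax
  obtain ⟨v, hv, hv0⟩ := hF0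
  have h2 := F.stage2 f _ hfk _ (em a) rfl 0 (by have := hi a b; omega) v hv
  have hmon : ∀ a' , (MvPowerSeries.coeff (em a) (tay A n (MvPolynomial.monomial (em a') (c a' b)))) • v =
      c a' b • (MvPowerSeries.coeff (em a) (tay A n (MvPolynomial.monomial (em a') 1))) • v := by
    intro a'
    have : MvPolynomial.monomial (em a') (c a' b) =
      c a' b • (MvPolynomial.monomial (em a') 1 : MvPolynomial (Fin n) A) := by
      rw [MvPolynomial.smul_monomial, smul_eq_mul, mul_one]
    rw [this, map_smul, ← smul_assoc]
    rfl
  rw [hf, map_sum, map_sum, Finset.sum_smul, Finset.sum_eq_single a, hmon] at h2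
  · obtain ⟨e, -, he, he'⟩ := tay_monomial_coeff (A := A) (em a) (em a)
    rw [he le_rfl, he' rfl, tsub_self] at h2
    have h3 : c a b • v = 0 := by simpa using h2
    obtain ⟨y, hy⟩ := hm.exists_inv ha
    obtain ⟨z, hz, hyz⟩ := hy
    apply hv0
    rw [← one_smul A v, ← hyz, add_smul, mul_smul, h3, smul_zero, hkill z hz, add_zero]
  · intro a' _ hne
    rw [hmon]
    by_cases hle : em a ≤ em a'
    · have hlt := degree_lt_of_le_ne hle (fun e => hne (hem e).symm)
      apply hkill
      by_contra hc
      exact absurd (hamax a' hc) (by omega)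
    · obtain ⟨e, he, -, -⟩ := tay_monomial_coeff (A := A) (em a') (em a)
      rw [he hle]; simp
  · simp

end Joseph

section Len
variable {A : Type u} [CommRing A]

lemma exists_span_card_le (k : ℕ) : ∀ (V : Type u) [AddCommGroup V] [Module A V],
    Module.length A V ≤ k → ∃ s : Finset V, s.card ≤ k ∧ Submodule.span A (s : Set V) = ⊤ := by
  classical
  induction k with
  | zero =>
    intro V _ _ h
    have : Module.length A V = 0 := by simpa using h
    rw [Module.length_eq_zero_iff] at this
    exact ⟨∅, by simp, Subsingleton.elim _ _⟩
  | succ k ih =>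
    intro V _ _ h
    by_cases hV : Subsingleton V
    · exact ⟨∅, by simp, Subsingleton.elim _ _⟩
    rw [not_subsingleton_iff_nontrivial] at hV
    obtain ⟨v, hv⟩ := exists_ne (0 : V)
    let S : Submodule A V := Submodule.span A {v}
    have hle := Module.length_eq_add_of_exact S.subtype S.mkQ S.injective_subtype S.mkQ_surjective
      (LinearMap.exact_subtype_mkQ S)
    have hS : Module.length A S ≠ 0 := by
      rw [Ne, Module.length_eq_zero_iff]
      intro hs
      apply hv
      have := Subsingleton.elim (⟨v, Submodule.mem_span_singleton_self v⟩ : S) 0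
      exact congrArg Subtype.val this
    have hq : Module.length A (V ⧸ S) ≤ k := by
      rw [hle] at h
      have h1 : 1 ≤ Module.length A S := Order.one_le_iff_ne_zero.2 hS
      have h2 : 1 + Module.length A (V ⧸ S) ≤ 1 + k := by
        calc _ ≤ _ := add_le_add_left h1 _
          _ ≤ _ := h
          _ = _ := by push_cast; rw [add_comm]
      exact (ENat.add_le_add_iff_left (by simp)).1 h2
    obtain ⟨t, ht, hspan⟩ := ih (V ⧸ S) hq
    let σ : V ⧸ S → V := Function.surjInv S.mkQ_surjective
    have hσ : ∀ x, S.mkQ (σ x) = x := Function.surjInv_eq S.mkQ_surjective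
    refine ⟨insert v (t.image σ), ?_, ?_⟩
    · calc _ ≤ _ := Finset.card_insert_le _ _
        _ ≤ _ := by have := Finset.card_image_le (s := t) (f := σ); omega
    · rw [Finset.coe_insert, Submodule.span_insert, eq_top_iff]
      intro x _
      have hx : S.mkQ x ∈ (Submodule.span A (t.image σ : Set V)).map S.mkQ := by
        rw [Submodule.map_span, Finset.coe_image, ← Set.image_comp]
        have : (S.mkQ ∘ σ) = id := funext hσ
        rw [this, Set.image_id, hspan]; trivial
      obtain ⟨y, hy, hxy⟩ := hx
      have : x - y ∈ S := by
        rw [← Submodule.ker_mkQ S, LinearMap.mem_ker, map_sub, hxy, sub_self]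
      rw [← sub_add_cancel x y]
      exact Submodule.add_mem_sup this hy

end Len
end
end LCF

namespace LCF
noncomputable section

section Lower
variable {A : Type u} [CommRing A] {n : ℕ} {M : Type u} [AddCommGroup M] [Module A M]
  [Module (MvPolynomial (Fin n) A) M] [IsScalarTower A (MvPolynomial (Fin n) A) M]

lemma Filt.monomial_mem {D : DStr A n M} (F : Filt D) (α : Fin n →₀ ℕ) :
    ∀ j m, m ∈ F.F j → (MvPolynomial.monomial α 1 : MvPolynomial (Fin n) A) • m ∈
      F.F (j + α.degree) := by
  induction α using finsupp_ind with
  | h0 => intro j m hm; simpa using hm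
  | h1 α k ih =>
    intro j m hm
    have e1 : (MvPolynomial.monomial (α + Finsupp.single k 1) (1 : A)) =
      MvPolynomial.monomial α 1 * MvPolynomial.X k := by
      rw [MvPolynomial.X, MvPolynomial.monomial_mul, mul_one]
    rw [e1, mul_smul, map_add, Finsupp.degree_single]
    have := ih _ _ (F.X_mem j k m hm)
    rwa [show j + (α.degree + 1) = j + 1 + α.degree by omega]

/-- multi-indices in a box -/
def boxEm (n s : ℕ) (a : Fin n → Fin s) : Fin n →₀ ℕ :=
  Finsupp.equivFunOnFinite.symm (fun j => (a j : ℕ))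

lemma boxEm_inj (n s : ℕ) : Function.Injective (boxEm n s) := by
  intro a b h
  have := Finsupp.equivFunOnFinite.symm.injective h
  funext j
  exact Fin.ext (congrFun this j)

lemma boxEm_degree (n s : ℕ) (a : Fin n → Fin s) : (boxEm n s a).degree ≤ n * (s - 1) := by
  rw [Finsupp.degree_eq_sum]
  calc _ ≤ ∑ _j : Fin n, (s - 1) := Finset.sum_le_sum (fun j _ => by
        change ((a j : Fin s) : ℕ) ≤ s - 1
        have := (a j).2; omega)
    _ = _ := by simp

lemma length_ge_of_ker_le {ι : Type} [Fintype ι] (𝔪 : Ideal A) (hm : 𝔪.IsMaximal)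
    {V : Type u} [AddCommGroup V] [Module A V] (Φ : (ι → A) →ₗ[A] V)
    (h : ∀ c, Φ c = 0 → ∀ p, c p ∈ 𝔪) : (Fintype.card ι : ℕ∞) ≤ Module.length A V := by
  have hs : IsSimpleModule A (A ⧸ 𝔪) := isSimpleModule_iff_isCoatom.2 (Ideal.isMaximal_def.1 hm)
  let ρ : (ι → A) →ₗ[A] (ι → A ⧸ 𝔪) := LinearMap.pi (fun p => 𝔪.mkQ ∘ₗ LinearMap.proj p)
  have hρ : Function.Surjective ρ := by
    intro y
    choose c hc using fun p => 𝔪.mkQ_surjective (y p)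
    exact ⟨c, funext hc⟩
  have hker : LinearMap.ker Φ ≤ LinearMap.ker ρ := by
    intro c hc
    rw [LinearMap.mem_ker] at hc ⊢
    funext p
    exact (Submodule.Quotient.mk_eq_zero 𝔪).2 (h c hc p)
  have h1 : Module.length A (ι → A ⧸ 𝔪) = Fintype.card ι := by
    rw [Module.length_pi_of_fintype]
    have : Module.length A (A ⧸ 𝔪) = 1 := Module.length_eq_one A (A ⧸ 𝔪)
    simp [this]
  rw [← h1]
  have h2 : Function.Surjective ((LinearMap.ker Φ).liftQ ρ hker) := by
    intro y
    obtain ⟨c, rfl⟩ := hρ y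
    exact ⟨Submodule.Quotient.mk c, rfl⟩
  calc _ ≤ Module.length A ((ι → A) ⧸ LinearMap.ker Φ) := Module.length_le_of_surjective _ h2
    _ = Module.length A (LinearMap.range Φ) := Φ.quotKerEquivRange.length_eq
    _ ≤ _ := Module.length_le_of_injective _ (LinearMap.range Φ).injective_subtype

lemma Filt.lower1 {D : DStr A n M} (F : Filt D) (𝔪 : Ideal A) (hm : 𝔪.IsMaximal)
    (hkill : ∀ a ∈ 𝔪, ∀ m : M, a • m = 0) (hF0 : ∃ v ∈ F.F 0, v ≠ 0) (s i : ℕ)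
    (hsi : 2 * (n * (s - 1)) ≤ i) : ((s ^ n : ℕ) : ℕ∞) ≤ Module.length A (F.F (2 * i)) := by
  classical
  by_cases htop : Module.length A (F.F (2 * i)) = ⊤
  · rw [htop]; exact le_top
  obtain ⟨L2, hL2⟩ := ENat.ne_top_iff_exists.1 htop
  have hle : Module.length A (F.F i) ≤ Module.length A (F.F (2 * i)) :=
    Module.length_le_of_injective (Submodule.inclusion (F.mono (by omega)))
      (Submodule.inclusion_injective _)
  obtain ⟨t, ht, hspan⟩ := exists_span_card_le L2 (F.F i) (by rw [hL2]; exact hle)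
  let κ := Fin n → Fin s
  let em : κ → Fin n →₀ ℕ := boxEm n s
  have hdeg : ∀ a b : κ, (em a).degree + (em b).degree ≤ i := fun a b => by
    have h1 := boxEm_degree n s a
    have h2 := boxEm_degree n s b
    change (boxEm n s a).degree + (boxEm n s b).degree ≤ i
    omega
  have hw : ∀ (p : κ × κ) (m : F.F i),
      (MvPolynomial.monomial (em p.1) 1 : MvPolynomial (Fin n) A) • D.d (em p.2) (m : M) ∈
        F.F (2 * i) := fun p m => by
    apply F.mono _ (F.monomial_mem (em p.1) _ _ (F.d_mem i (em p.2) m m.2))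
    have := hdeg p.1 p.2
    omega
  let Φ : (κ × κ → A) →ₗ[A] (t → F.F (2 * i)) :=
    LinearMap.pi (fun k => ∑ p, (LinearMap.proj p).smulRight (⟨_, hw p k⟩ : F.F (2 * i)))
  have hΦ : ∀ c, Φ c = 0 → ∀ p, c p ∈ 𝔪 := by
    intro c hc p
    have key := F.joseph 𝔪 hm hkill hF0 em (boxEm_inj n s) i hdeg (fun a b => c (a, b))
    apply key _ p.1 p.2
    let Θ : F.F i →ₗ[A] M := ∑ p, (c p) • ((Algebra.lsmul A A M (MvPolynomial.monomial (em p.1) 1 : MvPolynomial (Fin n) A)) ∘ₗ D.d (em p.2) ∘ₗ (F.F i).subtype)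
    have hΘ : Θ = 0 := by
      apply LinearMap.ext_on hspan
      intro k hk
      have h1 := congrArg (fun y => ((y ⟨k, hk⟩ : F.F (2 * i)) : M)) hc
      simp only [Φ, LinearMap.pi_apply, LinearMap.sum_apply, LinearMap.smulRight_apply,
        LinearMap.proj_apply, Submodule.coe_sum, Submodule.coe_smul, Pi.zero_apply,
        Submodule.coe_zero] at h1
      simpa [Θ] using h1
    intro m hm'
    have h2 := LinearMap.congr_fun hΘ ⟨m, hm'⟩
    simp only [Θ, LinearMap.sum_apply, LinearMap.smul_apply, LinearMap.comp_apply,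
      Submodule.subtype_apply, LinearMap.zero_apply] at h2
    rw [← h2, Fintype.sum_prod_type_right]
    apply Finset.sum_congr rfl
    intro b _
    rw [Finset.sum_smul]
    apply Finset.sum_congr rfl
    intro a _
    rw [monomial_smul_eq]; rfl
  have h3 := length_ge_of_ker_le 𝔪 hm Φ hΦ
  rw [Module.length_pi_of_fintype] at h3
  simp only [Finset.sum_const, Finset.card_univ, ← hL2, Fintype.card_prod, Fintype.card_coe] at h3
  have h4 : Fintype.card κ = s ^ n := by simp [κ]
  rw [h4] at h3
  have h5 : s ^ n * s ^ n ≤ t.card * L2 := by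
    rw [nsmul_eq_mul] at h3
    exact_mod_cast h3
  rw [← hL2]
  norm_cast
  by_contra hcon
  push Not at hcon
  have : t.card * L2 ≤ L2 * L2 := Nat.mul_le_mul_right _ ht
  nlinarith

lemma Filt.lower2 {D : DStr A n M} (F : Filt D) (𝔪 : Ideal A) (hm : 𝔪.IsMaximal)
    (hkill : ∀ a ∈ 𝔪, ∀ m : M, a • m = 0) (hF0 : ∃ v ∈ F.F 0, v ≠ 0) (j : ℕ) :
    (((j + 1) ^ n : ℕ) : ℕ∞) ≤ ((4 * (n + 1)) ^ n : ℕ) * Module.length A (F.F j) := by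
  set s := j / (4 * (n + 1)) + 1 with hs
  have h1 := F.lower1 𝔪 hm hkill hF0 s (j / 2) (by
    have : j / (4 * (n + 1)) = j / 2 / (2 * (n + 1)) := by
      rw [Nat.div_div_eq_div_mul]; congr 1; ring
    rw [hs, this, Nat.add_sub_cancel]
    have h0 := Nat.div_mul_le_self (j / 2) (2 * (n + 1))
    generalize j / 2 / (2 * (n + 1)) = q at h0 ⊢
    generalize j / 2 = p at h0 ⊢
    nlinarith)
  have h2 : Module.length A (F.F (2 * (j / 2))) ≤ Module.length A (F.F j) :=
    Module.length_le_of_injective (Submodule.inclusion (F.mono (by omega)))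
      (Submodule.inclusion_injective _)
  have h3 : (j + 1) ^ n ≤ (4 * (n + 1)) ^ n * s ^ n := by
    rw [← mul_pow]
    apply Nat.pow_le_pow_left
    have := Nat.lt_div_mul_add (a := j) (b := 4 * (n + 1)) (by omega)
    rw [hs]
    nlinarith
  calc _ ≤ (((4 * (n + 1)) ^ n * s ^ n : ℕ) : ℕ∞) := by exact_mod_cast h3
    _ = ((4 * (n + 1)) ^ n : ℕ) * ((s ^ n : ℕ) : ℕ∞) := by push_cast; rfl
    _ ≤ _ := by gcongr; exact h1.trans h2

/-- the submodule killed by an ideal of the base ring -/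
def killed (𝔪 : Ideal A) (n : ℕ) (M : Type u) [AddCommGroup M] [Module A M]
  [Module (MvPolynomial (Fin n) A) M] [IsScalarTower A (MvPolynomial (Fin n) A) M] :
  Submodule (MvPolynomial (Fin n) A) M where
  carrier := {m | ∀ a ∈ 𝔪, a • m = 0}
  add_mem' := by
    intro x y hx hy a ha
    rw [smul_add, hx a ha, hy a ha, add_zero]
  zero_mem' := fun a _ => smul_zero a
  smul_mem' := by
    intro r x hx a ha
    rw [smul_comm, hx a ha, smul_zero]

lemma Filt.lower3 {D : DStr A n M} (F : Filt D) (i0 : ℕ) (hne : ∃ v ∈ F.F i0, v ≠ 0)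
    (hfin : Module.length A (F.F i0) ≠ ⊤) (j : ℕ) (hj : 2 * i0 ≤ j) :
    (((j + 1) ^ n : ℕ) : ℕ∞) ≤ ((8 * (n + 1)) ^ n : ℕ) * Module.length A (F.F j) := by
  obtain ⟨v, hv, hv0⟩ := hne
  have hfl := (Module.length_ne_top_iff).1 hfin
  have hart : IsArtinian A (F.F i0) := (isFiniteLength_iff_isNoetherian_isArtinian.1 hfl).2
  obtain h | ⟨S, hS, -⟩ := IsAtomic.eq_bot_or_exists_atom_le (⊤ : Submodule A (F.F i0))
  · exfalso
    apply hv0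
    have : (⟨v, hv⟩ : F.F i0) ∈ (⊤ : Submodule A (F.F i0)) := trivial
    rw [h, Submodule.mem_bot] at this
    exact congrArg Subtype.val this
  have hsimp := isSimpleModule_iff_isAtom.2 hS
  have hnt : Nontrivial S := hsimp.nontrivial
  obtain ⟨w, hw⟩ := exists_ne (0 : S)
  let 𝔪 := LinearMap.ker (LinearMap.toSpanSingleton A S w)
  have hmax : Ideal.IsMaximal 𝔪 := IsSimpleModule.ker_toSpanSingleton_isMaximal A hw
  let W := killed 𝔪 n M
  obtain ⟨D', hD'⟩ := D.exists_sub W.subtype W.injective_subtype (fun β x =>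
    ⟨⟨D.d β x, fun a ha => by rw [← map_smul, x.2 a ha, map_zero]⟩, rfl⟩)
  let F' := (F.shift i0).sub W.subtype D' hD'
  have hwW : ((w : F.F i0) : M) ∈ W := by
    intro a ha
    have h1 : a • w = 0 := by simpa [𝔪] using ha
    have := congrArg (fun y : S => ((y : F.F i0) : M)) h1
    simpa using this
  have h2 := F'.lower2 𝔪 hmax (fun a ha m => Subtype.ext (m.2 a ha))
    ⟨⟨_, hwW⟩, by
      change ((w : F.F i0) : M) ∈ F.F (0 + i0)
      rw [zero_add]; exact (w : F.F i0).2, by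
      intro h
      apply hw
      have h3 := congrArg Subtype.val h
      exact Subtype.ext (Subtype.ext h3)⟩ (j - i0)
  have h4 : Module.length A (F'.F (j - i0)) ≤ Module.length A (F.F j) := by
    let g : F'.F (j - i0) →ₗ[A] F.F j := LinearMap.codRestrict _ ((W.subtype.restrictScalars A) ∘ₗ (F'.F (j - i0)).subtype) (by
      intro c
      have h5 : ((c : W) : M) ∈ F.F (j - i0 + i0) := c.2
      rw [Nat.sub_add_cancel (by omega)] at h5
      exact h5)
    apply Module.length_le_of_injective g
    intro x y hxy
    have := congrArg Subtype.val hxy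
    exact Subtype.ext (Subtype.ext this)
  calc (((j + 1) ^ n : ℕ) : ℕ∞) ≤ ((2 ^ n * (j - i0 + 1) ^ n : ℕ) : ℕ∞) := by
        norm_cast
        rw [← mul_pow]
        apply Nat.pow_le_pow_left
        omega
    _ = ((2 ^ n : ℕ) : ℕ∞) * ((j - i0 + 1) ^ n : ℕ) := by push_cast; rfl
    _ ≤ ((2 ^ n : ℕ) : ℕ∞) * (((4 * (n + 1)) ^ n : ℕ) * Module.length A (F.F j)) := by
        gcongr
        exact h2.trans (by gcongr)
    _ = _ := by
        rw [← mul_assoc]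
        congr 1
        norm_cast
        rw [← mul_pow]; congr 1; ring

end Lower
end
end LCF

namespace LCF
noncomputable section

section FinAss
variable {A : Type u} [CommRing A] {n : ℕ}

lemma length_comap_map {M : Type u} [AddCommGroup M] [Module A M]
    (G : Submodule A M) {N Q : Type u} [AddCommGroup N] [Module A N] [AddCommGroup Q] [Module A Q]
    (f : N →ₗ[A] M) (g : M →ₗ[A] Q) (hf : Function.Injective f) (hfg : Function.Exact f g) :
    Module.length A G = Module.length A (G.comap f) + Module.length A (G.map g) := by
  apply Module.length_eq_add_of_exact (f.restrict (p := G.comap f) (q := G) (fun x hx => hx))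
    (g.restrict (p := G) (q := G.map g) (fun x hx => ⟨x, hx, rfl⟩))
  · intro x y hxy
    have := congrArg Subtype.val hxy
    exact Subtype.ext (hf this)
  · rintro ⟨_, ⟨x, hx, rfl⟩⟩
    exact ⟨⟨x, hx⟩, rfl⟩
  · rintro ⟨x, hx⟩
    constructor
    · intro h
      have h1 : g x = 0 := congrArg Subtype.val h
      obtain ⟨y, rfl⟩ := (hfg x).1 h1
      exact ⟨⟨y, hx⟩, rfl⟩
    · rintro ⟨⟨y, hy⟩, h⟩
      have h1 : f y = x := congrArg Subtype.val h
      apply Subtype.ext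
      exact (hfg x).2 ⟨y, h1⟩

theorem finite_ass [IsNoetherianRing A] (ℓ : ℕ) : ∀ (M : Type u) [AddCommGroup M] [Module A M]
    [Module (MvPolynomial (Fin n) A) M] [IsScalarTower A (MvPolynomial (Fin n) A) M]
    (D : DStr A n M) (F : Filt D) (i0 : ℕ)
    (_ : ∀ i, i0 ≤ i → ((8 * (n + 1)) ^ n : ℕ) * Module.length A (F.F i) ≤
      ((ℓ * (i + 1) ^ n : ℕ) : ℕ∞)), (associatedPrimes (MvPolynomial (Fin n) A) M).Finite := by
  have hK : (8 * (n + 1)) ^ n ≠ 0 := by positivity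
  generalize hKe : (8 * (n + 1)) ^ n = K at *
  induction ℓ with
  | zero =>
    intro M _ _ _ _ D F i0 h
    have : Subsingleton M := by
      refine ⟨fun x y => ?_⟩
      have key : ∀ z : M, z = 0 := by
        intro z
        obtain ⟨j, hj⟩ := F.ex z
        have h1 := h (i0 + j) (by omega)
        rw [zero_mul, Nat.cast_zero, nonpos_iff_eq_zero, mul_eq_zero] at h1
        have h2 : Module.length A (F.F (i0 + j)) = 0 :=
          h1.resolve_left (by exact_mod_cast hK)
        rw [Module.length_eq_zero_iff] at h2
        have := Subsingleton.elim (⟨z, F.mono (by omega) hj⟩ : F.F (i0 + j)) 0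
        exact congrArg Subtype.val this
      rw [key x, key y]
    rw [associatedPrimes.eq_empty_of_subsingleton]
    exact Set.finite_empty
  | succ ℓ ih =>
    intro M _ _ _ _ D F i0 h
    by_cases hM : Subsingleton M
    · rw [associatedPrimes.eq_empty_of_subsingleton]
      exact Set.finite_empty
    rw [not_subsingleton_iff_nontrivial] at hM
    obtain ⟨P, hP, hPmax⟩ := set_has_maximal_iff_noetherian.2
      (inferInstance : IsNoetherian (MvPolynomial (Fin n) A) (MvPolynomial (Fin n) A))
      (associatedPrimes (MvPolynomial (Fin n) A) M) (associatedPrimes.nonempty _ M)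
    have hP' := isAssociatedPrime_iff.1 hP
    obtain ⟨hPp, x, hx⟩ := hP'
    have hx' : ∀ r, r ∈ P ↔ r • x = 0 := by
      intro r
      rw [hx, Submodule.mem_colon_singleton, Submodule.mem_bot]
    have hx0 : x ≠ 0 := by
      rintro rfl
      exact hPp.ne_top ((Ideal.eq_top_iff_one _).2 ((hx' 1).2 (smul_zero _)))
    let W := tors P M
    have hxW : x ∈ W := ⟨1, fun r hr => (hx' r).1 (by simpa using hr)⟩
    obtain ⟨D', hD'⟩ := D.exists_sub W.subtype W.injective_subtype (fun β y =>
      ⟨⟨D.d β y, D.tors_stable P β _ y.2⟩, rfl⟩)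
    let F' := F.sub W.subtype D' hD'
    obtain ⟨D'', hD''⟩ := D.exists_quot W.mkQ W.mkQ_surjective (fun β m hm => by
      rw [← LinearMap.mem_ker, Submodule.ker_mkQ] at hm ⊢
      exact D.tors_stable P β _ hm)
    let F'' := F.quot W.mkQ W.mkQ_surjective D'' hD''
    have hexa : Function.Exact W.subtype W.mkQ := LinearMap.exact_subtype_mkQ W
    have hlen : ∀ i, Module.length A (F.F i) = Module.length A (F'.F i) + Module.length A (F''.F i) :=
      fun i => length_comap_map (F.F i) (W.subtype.restrictScalars A) (W.mkQ.restrictScalars A)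
        W.injective_subtype hexa
    have hAssW : associatedPrimes (MvPolynomial (Fin n) A) W ⊆ {P} := by
      intro Q hQ
      have hQM : Q ∈ associatedPrimes (MvPolynomial (Fin n) A) M :=
        IsAssociatedPrime.map_of_injective W.subtype hQ W.injective_subtype
      obtain ⟨hQp, w, hw⟩ := isAssociatedPrime_iff.1 hQ
      obtain ⟨k, hk⟩ := w.2
      have hle : P ≤ Q := by
        apply hQp.le_of_pow_le (n := k)
        intro r hr
        rw [hw, Submodule.mem_colon_singleton, Submodule.mem_bot]
        exact Subtype.ext (hk r hr)
      have := hPmax Q hQM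
      rw [Set.mem_singleton_iff]
      by_contra hne
      exact this (lt_of_le_of_ne hle (Ne.symm hne))
    obtain ⟨j, hj⟩ := F.ex x
    have hfin : Module.length A (F'.F (i0 + j)) ≠ ⊤ := by
      intro htop
      have h1 := h (i0 + j) (by omega)
      rw [hlen, htop, top_add, ENat.mul_top (by exact_mod_cast hK)] at h1
      exact absurd (top_le_iff.1 h1) (ENat.coe_ne_top _)
    have hlow := F'.lower3 (i0 + j) ⟨⟨x, hxW⟩, F.mono (by omega) hj, by
      intro h0; exact hx0 (congrArg Subtype.val h0)⟩ hfin
    rw [hKe] at hlow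
    have hquot := ih (M ⧸ W) D'' F'' (2 * (i0 + j)) (by
      intro i hi
      have h1 := h i (by omega)
      have h2 := hlow i hi
      rw [hlen, mul_add, add_mul, one_mul, add_comm (ℓ * _)] at h1
      push_cast at h1 h2 ⊢
      have h3 : ((i : ℕ∞) + 1) ^ n + (K : ℕ∞) * Module.length A (F''.F i) ≤
          ((i : ℕ∞) + 1) ^ n + ℓ * (i + 1) ^ n := le_trans (by gcongr) h1
      refine (ENat.add_le_add_iff_left ?_).1 h3
      exact_mod_cast ENat.coe_ne_top ((i + 1) ^ n))
    exact ((Set.finite_singleton P).subset hAssW |>.union hquot).subset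
      (associatedPrimes.subset_union_of_exact W.injective_subtype hexa)

end FinAss
end
end LCF

namespace LCF
noncomputable section

section Away
variable {A : Type u} [CommRing A] {n : ℕ} (g : MvPolynomial (Fin n) A)
  (S : Type u) [CommRing S] [Algebra (MvPolynomial (Fin n) A) S] [Algebra A S]
  [IsScalarTower A (MvPolynomial (Fin n) A) S] [IsLocalization.Away g S]

/-- Taylor expansion with coefficients in an algebra -/
def tayS : MvPolynomial (Fin n) A →+* MvPowerSeries (Fin n) S :=
  (MvPowerSeries.map (algebraMap (MvPolynomial (Fin n) A) S)).comp (tay A n).toRingHom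

lemma tayS_coeff (p : MvPolynomial (Fin n) A) (β) : MvPowerSeries.coeff β (tayS S p) =
    algebraMap _ S (MvPowerSeries.coeff β (tay A n p)) := by
  simp [tayS]

lemma tayS_unit : IsUnit (tayS S g) := by
  rw [MvPowerSeries.isUnit_iff_constantCoeff, ← MvPowerSeries.coeff_zero_eq_constantCoeff_apply,
    tayS_coeff, tay_coeff_zero]
  exact IsLocalization.Away.algebraMap_isUnit g

/-- Taylor expansion on a localization -/
def tau : S →+* MvPowerSeries (Fin n) S := IsLocalization.Away.lift g (tayS_unit g S)

lemma tau_alg (p : MvPolynomial (Fin n) A) : tau g S (algebraMap _ S p) = tayS S p :=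
  IsLocalization.Away.lift_eq g _ p

lemma tau_coeff_zero (s : S) : MvPowerSeries.coeff 0 (tau g S s) = s := by
  have : (MvPowerSeries.constantCoeff (σ := Fin n) (R := S)).comp (tau g S) = RingHom.id S := by
    apply IsLocalization.ringHom_ext (Submonoid.powers g)
    ext p
    · simp only [RingHom.comp_apply, tau_alg]
      rw [← MvPowerSeries.coeff_zero_eq_constantCoeff_apply, tayS_coeff, tay_coeff_zero]; rfl
    · simp only [RingHom.comp_apply, tau_alg]
      rw [← MvPowerSeries.coeff_zero_eq_constantCoeff_apply, tayS_coeff, tay_coeff_zero]; rfl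
  rw [MvPowerSeries.coeff_zero_eq_constantCoeff_apply]
  exact RingHom.congr_fun this s

lemma tau_A (a : A) : tau g S (algebraMap A S a) = MvPowerSeries.C (algebraMap A S a) := by
  rw [IsScalarTower.algebraMap_apply A (MvPolynomial (Fin n) A) S, tau_alg]
  rw [tayS, RingHom.comp_apply, MvPolynomial.algebraMap_eq]
  change MvPowerSeries.map _ (tay A n _) = _
  rw [tay_C, MvPowerSeries.map_C]

lemma tau_X (j) : tau g S (algebraMap (MvPolynomial (Fin n) A) S (MvPolynomial.X j)) =
    MvPowerSeries.C (algebraMap (MvPolynomial (Fin n) A) S (MvPolynomial.X j)) + MvPowerSeries.X j := by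
  rw [tau_alg, tayS, RingHom.comp_apply]
  change MvPowerSeries.map _ (tay A n _) = _
  rw [tay_X, map_add, MvPowerSeries.map_C, MvPowerSeries.map_X]

/-- the differential structure on a localization -/
def awayD : DStr A n S where
  d β :=
    { toFun := fun s => MvPowerSeries.coeff β (tau g S s)
      map_add' := fun x y => by rw [map_add, map_add]
      map_smul' := fun a x => by
        rw [Algebra.smul_def, map_mul, tau_A, MvPowerSeries.coeff_C_mul, RingHom.id_apply,
          Algebra.smul_def] }
  d_zero := by
    ext s
    exact tau_coeff_zero g S s
  d_succ := by
    intro β j s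
    simp only [LinearMap.coe_mk, AddHom.coe_mk]
    rw [Algebra.smul_def, map_mul, tau_X, add_mul, map_add, coeff_X_mul_add,
      MvPowerSeries.coeff_C_mul, Algebra.smul_def]
  d_comm := by
    intro β j s h
    simp only [LinearMap.coe_mk, AddHom.coe_mk]
    rw [Algebra.smul_def, map_mul, tau_X, add_mul, map_add, coeff_X_mul_of _ _ _ h,
      MvPowerSeries.coeff_C_mul, Algebra.smul_def, add_zero]

lemma awayD_d (β) (s : S) : (awayD g S).d β s = MvPowerSeries.coeff β (tau g S s) := rfl

/-- polynomials of bounded total degree -/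
abbrev Td (A : Type u) [CommRing A] (n k : ℕ) : Submodule A (MvPolynomial (Fin n) A) :=
  MvPolynomial.restrictTotalDegree (Fin n) A k

lemma Td_mul {k l : ℕ} {p q : MvPolynomial (Fin n) A} (hp : p ∈ Td A n k) (hq : q ∈ Td A n l) :
    p * q ∈ Td A n (k + l) := by
  rw [MvPolynomial.mem_restrictTotalDegree] at *
  exact (MvPolynomial.totalDegree_mul p q).trans (by omega)

lemma Td_mono {k l : ℕ} (h : k ≤ l) {p : MvPolynomial (Fin n) A} (hp : p ∈ Td A n k) :
    p ∈ Td A n l := by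
  rw [MvPolynomial.mem_restrictTotalDegree] at *
  omega

lemma Td_pow {k : ℕ} (m : ℕ) {p : MvPolynomial (Fin n) A} (hp : p ∈ Td A n k) :
    p ^ m ∈ Td A n (m * k) := by
  rw [MvPolynomial.mem_restrictTotalDegree] at *
  exact (MvPolynomial.totalDegree_pow p m).trans (Nat.mul_le_mul_left _ hp)

lemma degree_le_of_mem_support {p : MvPolynomial (Fin n) A} {v} (hv : v ∈ p.support) :
    v.degree ≤ p.totalDegree := by
  have := MvPolynomial.le_totalDegree hv
  rwa [Finsupp.sum_fintype _ _ (fun _ => rfl), ← Finsupp.degree_eq_sum] at this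

lemma Td_monomial {k : ℕ} {v : Fin n →₀ ℕ} (c : A) (h : v.degree ≤ k) :
    MvPolynomial.monomial v c ∈ Td A n k := by
  rw [MvPolynomial.mem_restrictTotalDegree]
  refine (MvPolynomial.totalDegree_monomial_le _ _).trans ?_
  rw [Finsupp.sum_fintype _ _ (fun _ => rfl)]
  rw [Finsupp.degree_eq_sum] at h
  exact h

lemma Td_tay {k : ℕ} {p : MvPolynomial (Fin n) A} (hp : p ∈ Td A n k) (β) :
    MvPowerSeries.coeff β (tay A n p) ∈ Td A n k := by
  have hp' := hp
  rw [MvPolynomial.mem_restrictTotalDegree] at hp'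
  rw [p.as_sum, map_sum, map_sum]
  apply Submodule.sum_mem
  intro v hv
  have h1 := (degree_le_of_mem_support hv).trans hp'
  have : MvPolynomial.monomial v (MvPolynomial.coeff v p) =
      MvPolynomial.coeff v p • (MvPolynomial.monomial v 1 : MvPolynomial (Fin n) A) := by
      rw [MvPolynomial.smul_monomial, smul_eq_mul, mul_one]
  rw [this, map_smul]
  refine Submodule.smul_mem (Td A n k) (MvPolynomial.coeff v p) ?_
  change MvPowerSeries.coeff β (tay A n (MvPolynomial.monomial v 1)) ∈ _
  obtain ⟨c, h2, h3, -⟩ := tay_monomial_coeff (A := A) v β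
  by_cases hle : β ≤ v
  · rw [h3 hle]
    exact Td_monomial _ ((Finsupp.degree_mono tsub_le_self).trans h1)
  · rw [h2 hle]; exact Submodule.zero_mem _

/-- filtration steps on the localization -/
def GF (i : ℕ) : Submodule A S :=
  (Td A n ((g.totalDegree + 1) * i)).map
    ((LinearMap.mulLeft A (IsLocalization.Away.invSelf (S := S) g ^ i)) ∘ₗ
      (IsScalarTower.toAlgHom A (MvPolynomial (Fin n) A) S).toLinearMap)

lemma mem_GF {i : ℕ} {s : S} : s ∈ GF g S i ↔ ∃ r ∈ Td A n ((g.totalDegree + 1) * i),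
    IsLocalization.Away.invSelf (S := S) g ^ i * algebraMap _ S r = s := Iff.rfl

lemma inv_mul_g : IsLocalization.Away.invSelf (S := S) g * algebraMap _ S g = 1 := by
  rw [mul_comm, IsLocalization.Away.mul_invSelf]

lemma GF_mul {i j : ℕ} {s t : S} (hs : s ∈ GF g S i) (ht : t ∈ GF g S j) :
    s * t ∈ GF g S (i + j) := by
  rw [mem_GF] at *
  obtain ⟨r, hr, rfl⟩ := hs
  obtain ⟨r', hr', rfl⟩ := ht
  refine ⟨r * r', by rw [mul_add]; exact Td_mul hr hr', ?_⟩
  rw [map_mul, pow_add]; ring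

lemma g_mem_Td : g ∈ Td A n g.totalDegree := by
  rw [MvPolynomial.mem_restrictTotalDegree]

lemma one_mem_GF (i : ℕ) : (1 : S) ∈ GF g S i := by
  rw [mem_GF]
  refine ⟨g ^ i, Td_mono ?_ (Td_pow i (g_mem_Td g)), ?_⟩
  · rw [mul_comm]; exact Nat.mul_le_mul_right _ (by omega)
  · rw [map_pow, ← mul_pow, inv_mul_g, one_pow]

lemma GF_mono : Monotone (GF g S) := by
  intro i j hij s hs
  obtain ⟨k, rfl⟩ := Nat.exists_eq_add_of_le hij
  have := GF_mul g S hs (one_mem_GF g S k)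
  rwa [mul_one] at this

/-- power series with filtered coefficients -/
def InG (k : ℕ) (φ : MvPowerSeries (Fin n) S) : Prop :=
  ∀ β, MvPowerSeries.coeff β φ ∈ GF g S (k + β.degree)

open Finset in
lemma InG_mul {k l : ℕ} {φ ψ : MvPowerSeries (Fin n) S} (h1 : InG g S k φ) (h2 : InG g S l ψ) :
    InG g S (k + l) (φ * ψ) := by
  classical
  intro β
  rw [MvPowerSeries.coeff_mul]
  apply Submodule.sum_mem
  rintro ⟨q1, q2⟩ hq
  rw [HasAntidiagonal.mem_antidiagonal] at hq
  have := GF_mul g S (h1 q1) (h2 q2)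
  dsimp only at hq ⊢
  rw [← hq, map_add]
  rwa [show k + l + (q1.degree + q2.degree) = k + q1.degree + (l + q2.degree) by omega]

lemma InG_one : InG g S 0 1 := by
  classical
  intro β
  rw [MvPowerSeries.coeff_one]
  split_ifs
  · exact one_mem_GF g S _
  · exact Submodule.zero_mem _

lemma InG_pow {φ : MvPowerSeries (Fin n) S} (h1 : InG g S 0 φ) (m : ℕ) : InG g S 0 (φ ^ m) := by
  induction m with
  | zero => rw [pow_zero]; exact InG_one g S
  | succ m ih =>
    have h2 := InG_mul g S ih h1
    rw [pow_succ]
    exact h2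

open Finset in
lemma InG_inv {χ ψ : MvPowerSeries (Fin n) S} (h1 : InG g S 0 ψ)
    (h0 : MvPowerSeries.coeff 0 ψ = 1) (h : χ * ψ = 1) : InG g S 0 χ := by
  classical
  have key : ∀ b : ℕ, ∀ β : Fin n →₀ ℕ, β.degree = b → MvPowerSeries.coeff β χ ∈ GF g S b := by
    intro b
    induction b using Nat.strong_induction_on with
    | _ b ih =>
    intro β hβ
    have h2 := congrArg (MvPowerSeries.coeff β) h
    have hmem : (β, (0 : Fin n →₀ ℕ)) ∈ antidiagonal β := by simp
    rw [MvPowerSeries.coeff_mul, ← Finset.add_sum_erase _ _ hmem, h0, mul_one] at h2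
    rw [eq_sub_of_add_eq h2]
    apply Submodule.sub_mem
    · rw [← hβ]; simpa using InG_one g S β
    · apply Submodule.sum_mem
      rintro ⟨q1, q2⟩ hq
      rw [mem_erase, HasAntidiagonal.mem_antidiagonal] at hq
      obtain ⟨hne, hq⟩ := hq
      dsimp only at hq ⊢
      have hdeg : q1.degree + q2.degree = b := by rw [← map_add, hq, hβ]
      have hq1 : q2.degree ≠ 0 := by
        rw [Ne, Finsupp.degree_eq_zero_iff]
        rintro rfl
        rw [add_zero] at hq
        exact hne (by rw [hq])
      have h3 := h1 q2
      rw [zero_add] at h3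
      have := GF_mul g S (ih q1.degree (by omega) q1 rfl) h3
      rwa [hdeg] at this
  intro β
  rw [zero_add]
  exact key _ β rfl

lemma InG_tau {i : ℕ} {s : S} (hs : s ∈ GF g S i) : InG g S i (tau g S s) := by
  set y := IsLocalization.Away.invSelf (S := S) g with hy
  have hyg : y * algebraMap _ S g = 1 := inv_mul_g g S
  have hψ : InG g S 0 (tayS S g * MvPowerSeries.C y) := by
    intro β
    rw [MvPowerSeries.coeff_mul_C, tayS_coeff, zero_add]
    by_cases hβ : β = 0
    · rw [hβ, tay_coeff_zero, mul_comm, hyg]; exact one_mem_GF g S _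
    · have : 1 ≤ β.degree := by
        by_contra hc
        apply hβ
        rw [← Finsupp.degree_eq_zero_iff]; omega
      apply GF_mono g S this
      rw [mem_GF]
      refine ⟨_, Td_mono ?_ (Td_tay (g_mem_Td g) β), ?_⟩
      · omega
      · rw [pow_one, mul_comm]
  have hχ : InG g S 0 (tau g S y * MvPowerSeries.C (algebraMap _ S g)) := by
    apply InG_inv g S hψ
    · rw [MvPowerSeries.coeff_mul_C, tayS_coeff, tay_coeff_zero, mul_comm, hyg]
    · rw [← tau_alg g S]
      calc _ = tau g S (y * algebraMap _ S g) * MvPowerSeries.C (y * algebraMap _ S g) := by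
            rw [map_mul, map_mul]; ring
        _ = 1 := by rw [hyg, map_one, map_one, mul_one]
  rw [mem_GF] at hs
  obtain ⟨r, hr, rfl⟩ := hs
  have h1 : InG g S i (MvPowerSeries.C (y ^ i) * tayS S r) := by
    intro β
    rw [MvPowerSeries.coeff_C_mul, tayS_coeff]
    apply GF_mono g S (Nat.le_add_right i _)
    rw [mem_GF]
    exact ⟨_, Td_tay hr β, rfl⟩
  have h2 := InG_mul g S h1 (InG_pow g S hχ i)
  rw [add_zero] at h2
  convert h2 using 1
  rw [map_mul, map_pow, tau_alg, mul_pow, ← map_pow MvPowerSeries.C]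
  have : (MvPowerSeries.C (y ^ i) : MvPowerSeries (Fin n) S) *
      MvPowerSeries.C (algebraMap _ S g ^ i) = 1 := by
    rw [← map_mul, ← mul_pow, hyg, one_pow, map_one]
  calc _ = tau g S y ^ i * tayS S r * 1 := by rw [mul_one]
    _ = _ := by rw [← this]; ring

/-- the filtration on the localization -/
def awayF : Filt (awayD g S) where
  F := GF g S
  mono := GF_mono g S
  X_mem := by
    intro i j m hm
    rw [add_comm, Algebra.smul_def]
    refine GF_mul g S ?_ hm
    rw [mem_GF]
    refine ⟨MvPolynomial.X j * g, ?_, ?_⟩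
    · have hX : (MvPolynomial.X j : MvPolynomial (Fin n) A) ∈ Td A n 1 := by
        exact Td_monomial _ (by rw [Finsupp.degree_single])
      exact Td_mono (by omega) (Td_mul hX (g_mem_Td g))
    · rw [pow_one, map_mul, mul_left_comm, inv_mul_g, mul_one]
  d_mem := fun i β m hm => InG_tau g S hm β
  ex := by
    intro s
    obtain ⟨k, r, hr⟩ := IsLocalization.Away.surj g s
    have hs : s = IsLocalization.Away.invSelf (S := S) g ^ k * algebraMap _ S r := by
      rw [← hr, mul_left_comm, ← mul_pow, inv_mul_g, one_pow, mul_one]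
    refine ⟨k + r.totalDegree, ?_⟩
    rw [mem_GF]
    refine ⟨r * g ^ r.totalDegree, ?_, ?_⟩
    · have h1 : r ∈ Td A n r.totalDegree := g_mem_Td r
      refine Td_mono ?_ (Td_mul h1 (Td_pow r.totalDegree (g_mem_Td g)))
      nlinarith
    · rw [map_mul, map_pow, hs, pow_add]
      calc _ = IsLocalization.Away.invSelf (S := S) g ^ k * algebraMap _ S r *
            (IsLocalization.Away.invSelf (S := S) g * algebraMap _ S g) ^ r.totalDegree := by ring
        _ = _ := by rw [inv_mul_g, one_pow, mul_one]

lemma Td_span (k : ℕ) : ∃ s : Finset (MvPolynomial (Fin n) A), s.card ≤ (k + 1) ^ n ∧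
    Td A n k = Submodule.span A (s : Set (MvPolynomial (Fin n) A)) := by
  classical
  let T : Finset (Fin n → Fin (k + 1)) := Finset.univ.filter (fun a => (boxEm n (k+1) a).degree ≤ k)
  refine ⟨T.image (fun a => MvPolynomial.monomial (boxEm n (k + 1) a) 1), ?_, ?_⟩
  · refine Finset.card_image_le.trans ((Finset.card_le_univ T).trans ?_)
    simp
  · apply le_antisymm
    · intro p hp
      rw [MvPolynomial.mem_restrictTotalDegree] at hp
      rw [p.as_sum]
      apply Submodule.sum_mem
      intro v hv
      have h1 := (degree_le_of_mem_support hv).trans hp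
      have : MvPolynomial.monomial v (MvPolynomial.coeff v p) =
        MvPolynomial.coeff v p • (MvPolynomial.monomial v 1 : MvPolynomial (Fin n) A) := by
        rw [MvPolynomial.smul_monomial, smul_eq_mul, mul_one]
      rw [this]
      apply Submodule.smul_mem
      apply Submodule.subset_span
      rw [Finset.coe_image]
      have hvj : ∀ j, v j < k + 1 := fun j => by
        have := Finsupp.le_degree j v
        omega
      have hev : boxEm n (k + 1) (fun j => ⟨v j, hvj j⟩) = v := Finsupp.ext (fun j => rfl)
      refine ⟨fun j => ⟨v j, hvj j⟩, ?_, ?_⟩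
      · simp only [T, Finset.coe_filter, Finset.mem_univ, true_and, Set.mem_setOf_eq]
        rw [hev]; exact h1
      · dsimp only
        rw [hev]
    · rw [Submodule.span_le]
      intro p hp
      rw [Finset.coe_image] at hp
      obtain ⟨a, ha, rfl⟩ := hp
      simp only [T, Finset.coe_filter, Finset.mem_univ, true_and, Set.mem_setOf_eq] at ha
      change _ ∈ Td A n k
      exact Td_monomial _ ha

lemma GF_span (i : ℕ) : ∃ s : Finset S, s.card ≤ (g.totalDegree + 2) ^ n * (i + 1) ^ n ∧
    GF g S i = Submodule.span A (s : Set S) := by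
  classical
  obtain ⟨s, hs, hspan⟩ := Td_span (A := A) (n := n) ((g.totalDegree + 1) * i)
  refine ⟨s.image ((LinearMap.mulLeft A (IsLocalization.Away.invSelf (S := S) g ^ i)) ∘ₗ
      (IsScalarTower.toAlgHom A (MvPolynomial (Fin n) A) S).toLinearMap), ?_, ?_⟩
  · refine Finset.card_image_le.trans (hs.trans ?_)
    rw [← mul_pow]
    apply Nat.pow_le_pow_left
    nlinarith
  · rw [GF, hspan, Submodule.map_span, Finset.coe_image]

end Away
end
end LCF

namespace LCF
noncomputable section

/-- bundled modules with differential structure -/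
structure DMod (A : Type u) [CommRing A] (n : ℕ) where
  carrier : Type u
  [acg : AddCommGroup carrier]
  [modA : Module A carrier]
  [modR : Module (MvPolynomial (Fin n) A) carrier]
  [tower : IsScalarTower A (MvPolynomial (Fin n) A) carrier]
  D : DStr A n carrier

attribute [instance] DMod.acg DMod.modA DMod.modR DMod.tower

section GoodSec
variable {A : Type u} [CommRing A] {n : ℕ}

/-- product structure -/
def DStr.prod {M N : Type u} [AddCommGroup M] [Module A M]
  [Module (MvPolynomial (Fin n) A) M] [AddCommGroup N] [Module A N]
  [Module (MvPolynomial (Fin n) A) N] (D : DStr A n M) (D' : DStr A n N) : DStr A n (M × N) where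
  d β := (D.d β).prodMap (D'.d β)
  d_zero := by rw [D.d_zero, D'.d_zero]; rfl
  d_succ := by
    rintro β j ⟨x, y⟩
    simp [D.d_succ, D'.d_succ]
  d_comm := by
    rintro β j ⟨x, y⟩ h
    simp [D.d_comm _ _ _ h, D'.d_comm _ _ _ h]

/-- localization as a bundled module -/
abbrev DMod.away (g : MvPolynomial (Fin n) A) : DMod A n where
  carrier := Localization.Away g
  D := awayD g (Localization.Away g)

/-- product as a bundled module -/
abbrev DMod.prod (M N : DMod A n) : DMod A n where
  carrier := M.carrier × N.carrier
  D := M.D.prod N.D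

/-- finite products of localizations -/
inductive Good : DMod A n → Prop
  | base (g : MvPolynomial (Fin n) A) : Good (DMod.away g)
  | prod (M N : DMod A n) : Good M → Good N → Good (M.prod N)

lemma flat_prod (R M N : Type u) [CommRing R] [AddCommGroup M] [Module R M] [AddCommGroup N]
    [Module R N] (hM : Module.Flat R M) (hN : Module.Flat R N) : Module.Flat R (M × N) := by
  rw [Module.Flat.iff_lTensor_preserves_injective_linearMap]
  intro P Q _ _ _ _ f hf
  have h1 := Module.Flat.lTensor_preserves_injective_linearMap (M := M) f hf
  have h2 := Module.Flat.lTensor_preserves_injective_linearMap (M := N) f hf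
  have key : ∀ z, TensorProduct.prodLeft R R M N Q (f.lTensor (M × N) z) =
      (f.lTensor M (TensorProduct.prodLeft R R M N P z).1,
        f.lTensor N (TensorProduct.prodLeft R R M N P z).2) := by
    intro z
    induction z with
    | zero => simp; rfl
    | tmul x y => obtain ⟨x1, x2⟩ := x; simp
    | add x y hx hy => simp only [map_add, hx, hy, Prod.fst_add, Prod.snd_add, Prod.mk_add_mk]
  intro z w hzw
  have h3 := (key z).symm.trans ((congrArg _ hzw).trans (key w))
  apply (TensorProduct.prodLeft R R M N P).injective
  exact Prod.ext (h1 (Prod.ext_iff.1 h3).1) (h2 (Prod.ext_iff.1 h3).2)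

lemma prod_span {A M N : Type u} [CommRing A] [AddCommGroup M] [Module A M] [AddCommGroup N]
    [Module A N] (s : Finset M) (t : Finset N) : ∃ u : Finset (M × N), u.card ≤ s.card + t.card ∧
    (Submodule.span A (s : Set M)).prod (Submodule.span A (t : Set N)) =
      Submodule.span A (u : Set (M × N)) := by
  classical
  refine ⟨s.image (LinearMap.inl A M N) ∪ t.image (LinearMap.inr A M N), ?_, ?_⟩
  · refine (Finset.card_union_le _ _).trans ?_
    have h1 := Finset.card_image_le (s := s) (f := LinearMap.inl A M N)
    have h2 := Finset.card_image_le (s := t) (f := LinearMap.inr A M N)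
    omega
  · rw [Finset.coe_union, Finset.coe_image, Finset.coe_image]
    exact LinearMap.span_inl_union_inr.symm

lemma Good.flat {M : DMod A n} (h : Good M) : Module.Flat (MvPolynomial (Fin n) A) M.carrier := by
  induction h with
  | base g => exact inferInstanceAs (Module.Flat _ (Localization.Away g))
  | prod M N _ _ hM hN =>
    exact flat_prod _ _ _ hM hN

lemma Good.filt {M : DMod A n} (h : Good M) : ∃ (F : Filt M.D) (C : ℕ), ∀ i,
    ∃ s : Finset M.carrier, s.card ≤ C * (i + 1) ^ n ∧
      F.F i = Submodule.span A (s : Set M.carrier) := by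
  classical
  induction h with
  | base g =>
    exact ⟨awayF g (Localization.Away g), (g.totalDegree + 2) ^ n,
      fun i => GF_span g (Localization.Away g) i⟩
  | prod M N _ _ hM hN =>
    obtain ⟨F, C, hF⟩ := hM
    obtain ⟨F', C', hF'⟩ := hN
    let G : Filt (M.prod N).D :=
      { F := fun i => (F.F i).prod (F'.F i)
        mono := fun i j hij => Submodule.prod_mono (F.mono hij) (F'.mono hij)
        X_mem := fun i j m hm => ⟨F.X_mem i j m.1 hm.1, F'.X_mem i j m.2 hm.2⟩
        d_mem := fun i β m hm => ⟨F.d_mem i β m.1 hm.1, F'.d_mem i β m.2 hm.2⟩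
        ex := by
          rintro ⟨x, y⟩
          obtain ⟨i, hi⟩ := F.ex x
          obtain ⟨j, hj⟩ := F'.ex y
          exact ⟨i + j, F.mono (by omega) hi, F'.mono (by omega) hj⟩ }
    refine ⟨G, C + C', fun i => ?_⟩
    obtain ⟨s, hs, hs'⟩ := hF i
    obtain ⟨t, ht, ht'⟩ := hF' i
    obtain ⟨u, hu, hu'⟩ := prod_span (A := A) s t
    refine ⟨u, ?_, ?_⟩
    · rw [add_mul]
      omega
    · change (F.F i).prod (F'.F i) = _
      rw [hs', ht', hu']

lemma away_loc (g f : MvPolynomial (Fin n) A) :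
    ∃ ℓ : Localization.Away g →ₗ[MvPolynomial (Fin n) A] Localization.Away (g * f),
      IsLocalizedModule (Submonoid.powers f) ℓ ∧
      ∀ β m, ℓ ((awayD g (Localization.Away g)).d β m) =
        (awayD (g * f) (Localization.Away (g * f))).d β (ℓ m) := by
  let S := Localization.Away g
  let T := Localization.Away (g * f)
  have hgf : IsUnit (algebraMap (MvPolynomial (Fin n) A) T (g * f)) :=
    IsLocalization.Away.algebraMap_isUnit (g * f)
  rw [map_mul, IsUnit.mul_iff] at hgf
  let φ : S →+* T := IsLocalization.Away.lift g hgf.1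
  have hφ : ∀ r, φ (algebraMap _ S r) = algebraMap _ T r := fun r =>
    IsLocalization.Away.lift_eq g hgf.1 r
  let ℓ : S →ₗ[MvPolynomial (Fin n) A] T :=
    { toFun := φ
      map_add' := map_add φ
      map_smul' := fun r s => by
        rw [Algebra.smul_def, map_mul, hφ, RingHom.id_apply, Algebra.smul_def] }
  have hℓ : ∀ s, ℓ s = φ s := fun s => rfl
  refine ⟨ℓ, ⟨?_, ?_, ?_⟩, ?_⟩
  · rintro ⟨_, k, rfl⟩
    have h1 : IsUnit (algebraMap (MvPolynomial (Fin n) A) T (f ^ k)) := by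
      rw [map_pow]; exact hgf.2.pow k
    have := h1.map (Algebra.lmul (MvPolynomial (Fin n) A) T)
    rwa [AlgHom.commutes] at this
  · intro y
    obtain ⟨k, a, hy⟩ := IsLocalization.Away.surj (g * f) y
    refine ⟨⟨IsLocalization.Away.invSelf (S := S) g ^ k * algebraMap _ S a, ⟨f ^ k, k, rfl⟩⟩, ?_⟩
    dsimp only
    rw [hℓ, map_mul, hφ, ← hy, map_mul, mul_pow, Submonoid.smul_def, Algebra.smul_def, map_pow,
      map_pow]
    have h1 : φ (IsLocalization.Away.invSelf (S := S) g) * algebraMap _ T g = 1 := by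
      rw [← hφ, ← map_mul, inv_mul_g, map_one]
    calc _ = (1 : T) ^ k * (algebraMap _ T f ^ k * y) := by rw [one_pow, one_mul]
      _ = _ := by rw [← h1, mul_pow]; ring
  · intro x y hxy
    have key : ∀ z : S, φ z = 0 → ∃ k, f ^ k • z = 0 := by
      intro z hz
      obtain ⟨k, a, hy⟩ := IsLocalization.Away.surj g z
      have h1 : algebraMap _ T a = algebraMap _ T (0 : MvPolynomial (Fin n) A) := by
        rw [← hφ, ← hy, map_mul, hz, zero_mul, map_zero]
      obtain ⟨⟨_, m, rfl⟩, hc⟩ := IsLocalization.exists_of_eq (M := Submonoid.powers (g * f)) h1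
      refine ⟨m, ?_⟩
      have hc' : (g * f) ^ m * a = (g * f) ^ m * 0 := hc
      rw [mul_zero] at hc'
      have h2 : algebraMap _ S ((g * f) ^ m * a) = 0 := by rw [hc', map_zero]
      rw [map_mul, ← hy, mul_pow, map_mul, map_pow] at h2
      have hu : IsUnit (algebraMap (MvPolynomial (Fin n) A) S g) :=
        IsLocalization.Away.algebraMap_isUnit g
      have h3 : (algebraMap _ S g ^ m * algebraMap _ S g ^ k) * (algebraMap _ S (f ^ m) * z) = 0 := by
        rw [← h2]; ring
      rw [Algebra.smul_def]
      exact ((hu.pow m).mul (hu.pow k)).mul_right_eq_zero.1 h3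
    obtain ⟨k, hk⟩ := key (x - y) (by rw [map_sub, sub_eq_zero]; exact hxy)
    refine ⟨⟨f ^ k, k, rfl⟩, ?_⟩
    rw [Submonoid.smul_def, Submonoid.smul_def, ← sub_eq_zero, ← smul_sub]
    exact hk
  · intro β m
    have h1 : (tau (g * f) T).comp φ = (MvPowerSeries.map φ).comp (tau g S) := by
      apply IsLocalization.ringHom_ext (Submonoid.powers g)
      apply RingHom.ext
      intro r
      simp only [RingHom.comp_apply]
      rw [hφ, tau_alg, tau_alg]
      ext β
      rw [MvPowerSeries.coeff_map, tayS_coeff, tayS_coeff, hφ]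
    have h2 := RingHom.congr_fun h1 m
    simp only [RingHom.comp_apply] at h2
    rw [awayD_d, awayD_d, hℓ, hℓ, h2, MvPowerSeries.coeff_map]

lemma Good.loc {M : DMod A n} (h : Good M) (f : MvPolynomial (Fin n) A) :
    ∃ N : DMod A n, Good N ∧ ∃ ℓ : M.carrier →ₗ[MvPolynomial (Fin n) A] N.carrier,
      IsLocalizedModule (Submonoid.powers f) ℓ ∧ ∀ β m, ℓ (M.D.d β m) = N.D.d β (ℓ m) := by
  induction h with
  | base g => exact ⟨DMod.away (g * f), Good.base _, away_loc g f⟩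
  | prod M N _ _ hM hN =>
    obtain ⟨M', gM, ℓ, h1, h2⟩ := hM
    obtain ⟨N', gN, ℓ', h1', h2'⟩ := hN
    exact ⟨M'.prod N', Good.prod _ _ gM gN, ℓ.prodMap ℓ', IsLocalizedModule.prodMap _ _ _,
      fun β m => Prod.ext (h2 β m.1) (h2' β m.2)⟩

end GoodSec
end
end LCF

namespace LCF
noncomputable section
open TensorProduct

section CechSec
variable {R : Type u} [CommRing R]

/-- torsion elements -/
def Tor (I : Ideal R) {M : Type u} [AddCommGroup M] [Module R M] (m : M) : Prop :=
  ∃ t, ∀ r ∈ I ^ t, r • m = 0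

section
variable {I : Ideal R} {M : Type u} [AddCommGroup M] [Module R M] 

lemma Tor.smul {m : M} (h : Tor I m) (r : R) : Tor I (r • m) := by
  obtain ⟨t, ht⟩ := h
  exact ⟨t, fun s hs => by rw [smul_comm, ht s hs, smul_zero]⟩

lemma Tor.sup_iff (f : R) (m : M) : Tor (Ideal.span {f} ⊔ I) m ↔ Tor I m ∧ ∃ k : ℕ, f ^ k • m = 0 := by
  constructor
  · rintro ⟨t, ht⟩
    exact ⟨⟨t, fun r hr => ht r (Ideal.pow_right_mono le_sup_right t hr)⟩, t,
      ht _ (Ideal.pow_mem_pow (Ideal.mem_sup_left (Ideal.mem_span_singleton_self f)) t)⟩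
  · rintro ⟨⟨t, ht⟩, k, hk⟩
    refine ⟨k + t, fun r hr => ?_⟩
    have := Ideal.sup_pow_add_le_pow_sup_pow hr
    rw [Ideal.span_singleton_pow] at this
    obtain ⟨a, ha, b, hb, rfl⟩ := Submodule.mem_sup.1 this
    obtain ⟨c, rfl⟩ := Ideal.mem_span_singleton'.1 ha
    rw [add_smul, ht b hb, mul_smul, hk, smul_zero, add_zero]

lemma inj_ext [IsNoetherianRing R] (hJ : Module.Injective R M) (f : R) {m : M} (hm : Tor I m)
    (N : ℕ) : ∃ m' : M, Tor I m' ∧ ∃ t : ℕ, f ^ (N + t) • m' = f ^ t • m := by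
  obtain ⟨a, ha⟩ := hm
  let K : ℕ → Ideal R := fun k => Submodule.comap (LinearMap.lsmul R R (f ^ k)) (I ^ a)
  have hK : ∀ k r, r ∈ K k ↔ f ^ k * r ∈ I ^ a := fun k r => Iff.rfl
  have hmono : Monotone K := by
    intro i j hij r hr
    rw [hK] at hr ⊢
    obtain ⟨l, rfl⟩ := Nat.exists_eq_add_of_le hij
    rw [add_comm, pow_add, mul_assoc]
    exact Ideal.mul_mem_left _ _ hr
  obtain ⟨t, ht⟩ := monotone_stabilizes_iff_noetherian.2 (inferInstance : IsNoetherian R R) ⟨K, hmono⟩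
  have ht' : K t = K (N + t) := ht (N + t) (by omega)
  let φ : (R ⧸ K t) →ₗ[R] (R ⧸ I ^ a) :=
    Submodule.mapQ (K t) (I ^ a) (LinearMap.lsmul R R (f ^ (N + t))) (by rw [ht'])
  have hφ : Function.Injective φ := by
    rw [← LinearMap.ker_eq_bot, LinearMap.ker_eq_bot']
    intro x hx
    obtain ⟨r, rfl⟩ := Submodule.mkQ_surjective _ x
    have h1 : (I ^ a).mkQ (f ^ (N + t) * r) = 0 := hx
    rw [Submodule.mkQ_apply, Submodule.Quotient.mk_eq_zero] at h1
    rw [Submodule.mkQ_apply, Submodule.Quotient.mk_eq_zero, ht']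
    exact h1
  let ψ : (R ⧸ K t) →ₗ[R] M :=
    Submodule.liftQ (K t) (LinearMap.toSpanSingleton R M (f ^ t • m)) (by
      intro r hr
      rw [LinearMap.mem_ker, LinearMap.toSpanSingleton_apply, smul_smul, mul_comm]
      exact ha _ hr)
  obtain ⟨h, hh⟩ := hJ.out φ hφ ψ
  refine ⟨h ((I ^ a).mkQ 1), ⟨a, fun r hr => ?_⟩, t, ?_⟩
  · rw [← map_smul, ← map_smul, smul_eq_mul, mul_one, Submodule.mkQ_apply,
      (Submodule.Quotient.mk_eq_zero _).2 hr, map_zero]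
  · have := hh ((K t).mkQ 1)
    have h2 : φ ((K t).mkQ 1) = (I ^ a).mkQ (f ^ (N + t) * 1) := rfl
    have h3 : ψ ((K t).mkQ 1) = (1 : R) • f ^ t • m := rfl
    rw [h2, h3, one_smul, ← smul_eq_mul, map_smul, map_smul] at this
    exact this
end

section step
variable {I : Ideal R} {M C C' : Type u} [AddCommGroup M] [Module R M] [AddCommGroup C] [Module R C]
  [AddCommGroup C'] [Module R C'] (f : R) (d : C →ₗ[R] C) (d' : C' →ₗ[R] C') (l : C →ₗ[R] C')
  [IsLocalizedModule (Submonoid.powers f) l] 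

lemma loc_surj (u : C') : ∃ (k : ℕ) (c : C), f ^ k • u = l c := by
  obtain ⟨⟨c, ⟨_, k, rfl⟩⟩, h⟩ := IsLocalizedModule.surj (Submonoid.powers f) l u
  exact ⟨k, c, h⟩

lemma loc_zero {c : C} (h : l c = 0) : ∃ k : ℕ, f ^ k • c = 0 := by
  obtain ⟨⟨_, k, rfl⟩, h⟩ := (IsLocalizedModule.eq_zero_iff (Submonoid.powers f) l).1 h
  exact ⟨k, h⟩

lemma loc_bij {C C' : Type u} [AddCommGroup C] [Module R C]
    [AddCommGroup C'] [Module R C'] (f : R) (l : C →ₗ[R] C')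
    [IsLocalizedModule (Submonoid.powers f) l] (k : ℕ) : Function.Bijective (fun u : C' => f ^ k • u) := by
  have := IsLocalizedModule.map_units l (⟨f ^ k, k, rfl⟩ : Submonoid.powers f)
  exact (Module.End.isUnit_iff _).1 this

lemma step_ex (a : M →ₗ[R] C) (hd : ∀ c, l (d c) = d' (l c))
    (h1 : ∀ m, Tor I m → d (a m) = 0) (h2 : ∀ m c, Tor I m → d c = a m → m = 0)
    (h3 : ∀ c, d c = 0 → ∃ m, Tor I m ∧ ∃ b, c = a m + d b)
    (hext : ∀ m : M, Tor I m → ∀ N, ∃ m' : M, Tor I m' ∧ ∃ t : ℕ, f ^ (N + t) • m' = f ^ t • m)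
    (c : C) (u : C') (hc : d c = 0) (hu : l c = d' u) :
    ∃ m, Tor I m ∧ (∃ k : ℕ, f ^ k • m = 0) ∧ ∃ b v, c = a m + d b ∧ u = l b - d' v := by
  obtain ⟨m, hm, b, rfl⟩ := h3 c hc
  obtain ⟨k, c2, hk⟩ := loc_surj f l (u - l b)
  have e1 : l (a m) = d' (u - l b) := by
    rw [map_add, hd] at hu
    rw [map_sub, ← hu, add_sub_cancel_right]
  have e2 : l (f ^ k • a m - d c2) = 0 := by
    rw [map_sub, map_smul, e1, hd, ← hk, map_smul, sub_self]
  obtain ⟨j, hj⟩ := loc_zero f l e2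
  have e3 : f ^ j • f ^ k • m = 0 := by
    apply h2 _ (f ^ j • c2) ((hm.smul _).smul _)
    rw [smul_sub, sub_eq_zero] at hj
    rw [map_smul, map_smul, map_smul, hj]
  have e4 : f ^ (j + k) • m = 0 := by rw [pow_add, mul_smul, e3]
  have e5 : l (a m) = 0 := by
    apply (loc_bij f l (j + k)).1
    simp only
    rw [← map_smul, ← map_smul, e4, map_zero, map_zero, smul_zero]
  have e6 : l (d c2) = 0 := by rw [hd, ← hk, map_smul, ← e1, e5, smul_zero]
  obtain ⟨i, hi⟩ := loc_zero f l e6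
  rw [← map_smul] at hi
  obtain ⟨m2, hm2, b2, hb2⟩ := h3 _ hi
  obtain ⟨m3, hm3, t, ht⟩ := hext m2 hm2 (i + k)
  obtain ⟨v, hv⟩ := (loc_bij f l (i + k + t)).2 (l (f ^ t • b2))
  simp only at hv
  have e7 : u - l b = l (a m3) + d' v := by
    apply (loc_bij f l (i + k + t)).1
    simp only
    rw [smul_add, ← map_smul d', hv, ← map_smul l, ← map_smul a, ht, map_smul a, ← hd, ← map_add,
      map_smul d, ← smul_add, ← hb2, map_smul, map_smul, ← hk, smul_smul, smul_smul]
    congr 1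
    ring
  refine ⟨m, hm, ⟨j + k, e4⟩, b + a m3, -v, ?_, ?_⟩
  · rw [map_add, h1 m3 hm3, add_zero]
  · rw [map_add, map_neg, sub_neg_eq_add, add_assoc, ← e7, add_sub_cancel]
end step

/-- The Cech property. -/
structure Cech (I : Ideal R) {B : Type u} [AddCommGroup B] [Module R B] (δ : B →ₗ[R] B) (e : B) :
    Prop where
  cyc : ∀ (M : Type u) [AddCommGroup M] [Module R M] (m : M), Tor I m →
    δ.rTensor M (e ⊗ₜ m) = 0
  inj : ∀ (M : Type u) [AddCommGroup M] [Module R M] (m : M) (c), Tor I m →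
    δ.rTensor M c = e ⊗ₜ m → m = 0
  ex : ∀ (M : Type u) [AddCommGroup M] [Module R M], Module.Injective R M → ∀ c,
    δ.rTensor M c = 0 → ∃ m, Tor I m ∧ ∃ b, c = e ⊗ₜ m + δ.rTensor M b

lemma Cech.bot {B : Type u} [AddCommGroup B] [Module R B] (φ : R ≃ₗ[R] B) :
    Cech (⊥ : Ideal R) (0 : B →ₗ[R] B) (φ 1) where
  cyc M _ _ m _ := by simp
  inj M _ _ m c _ h := by
    rw [LinearMap.rTensor_zero, LinearMap.zero_apply] at h
    have := congrArg (fun z => TensorProduct.lid R M (φ.symm.toLinearMap.rTensor M z)) h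
    simpa using this.symm
  ex M _ _ _ c hc := by
    clear hc
    refine ⟨TensorProduct.lid R M (φ.symm.toLinearMap.rTensor M c), ⟨1, by simp⟩, 0, ?_⟩
    rw [map_zero, add_zero]
    induction c with
    | zero => simp
    | add x y hx hy => rw [map_add, map_add, tmul_add, ← hx, ← hy]
    | tmul b m =>
      obtain ⟨r, rfl⟩ := φ.surjective b
      simp only [LinearMap.rTensor_tmul, LinearEquiv.coe_coe, LinearEquiv.symm_apply_apply,
        TensorProduct.lid_tmul]
      rw [← smul_tmul, ← map_smul, smul_eq_mul, mul_one]

/-- the differential on the cone -/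
def cone {B B' : Type u} [AddCommGroup B] [Module R B] [AddCommGroup B'] [Module R B']
    (δ : B →ₗ[R] B) (δ' : B' →ₗ[R] B') (l : B →ₗ[R] B') : B × B' →ₗ[R] B × B' :=
  LinearMap.prod (δ.comp (LinearMap.fst R B B')) (l.comp (LinearMap.fst R B B') - 
    δ'.comp (LinearMap.snd R B B'))

lemma cone_apply {B B' : Type u} [AddCommGroup B] [Module R B] [AddCommGroup B'] [Module R B']
    (δ : B →ₗ[R] B) (δ' : B' →ₗ[R] B') (l : B →ₗ[R] B') (x : B × B') :
    cone δ δ' l x = (δ x.1, l x.1 - δ' x.2) := rfl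

lemma cone_tensor {B B' M : Type u} [AddCommGroup B] [Module R B] [AddCommGroup B'] [Module R B']
    [AddCommGroup M] [Module R M]
    (δ : B →ₗ[R] B) (δ' : B' →ₗ[R] B') (l : B →ₗ[R] B') (z : (B × B') ⊗[R] M) :
    prodLeft R R B B' M ((cone δ δ' l).rTensor M z) =
      (δ.rTensor M (prodLeft R R B B' M z).1,
        l.rTensor M (prodLeft R R B B' M z).1 - δ'.rTensor M (prodLeft R R B B' M z).2) := by
  induction z with
  | zero => simp; rfl
  | add x y hx hy =>
    simp only [map_add, hx, hy, Prod.fst_add, Prod.snd_add, Prod.mk_add_mk]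
    congr 1
    abel
  | tmul x m =>
    obtain ⟨b, b'⟩ := x
    simp [cone_apply, sub_tmul]

lemma Cech.step [IsNoetherianRing R] {I : Ideal R} {B B' : Type u} [AddCommGroup B] [Module R B]
    [AddCommGroup B'] [Module R B'] {δ : B →ₗ[R] B} {e : B} (h : Cech I δ e) (δ' : B' →ₗ[R] B')
    (f : R) (l : B →ₗ[R] B') [hl : IsLocalizedModule (Submonoid.powers f) l]
    (hd : ∀ c, l (δ c) = δ' (l c)) :
    Cech (Ideal.span {f} ⊔ I) (cone δ δ' l) (e, (0 : B')) := by
  have hloc : ∀ (M : Type u) [AddCommGroup M] [Module R M],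
      IsLocalizedModule (Submonoid.powers f) (l.rTensor M) := fun M _ _ =>
    IsLocalizedModule.rTensor (R := R) (A := R) (Submonoid.powers f) (N := M) l
  have hcom : ∀ (M : Type u) [AddCommGroup M] [Module R M] (c : B ⊗[R] M),
      l.rTensor M (δ.rTensor M c) = δ'.rTensor M (l.rTensor M c) := by
    intro M _ _ c
    rw [← LinearMap.comp_apply, ← LinearMap.comp_apply, ← LinearMap.rTensor_comp,
      ← LinearMap.rTensor_comp]
    congr 2
    ext c
    exact hd c
  have hpe : ∀ (M : Type u) [AddCommGroup M] [Module R M] (m : M),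
      prodLeft R R B B' M ((e, (0 : B')) ⊗ₜ[R] m) = (e ⊗ₜ m, 0) := by
    intro M _ _ m
    simp
  refine ⟨?_, ?_, ?_⟩
  · intro M _ _ m hm
    have := hloc M
    rw [Tor.sup_iff] at hm
    obtain ⟨hm, k, hk⟩ := hm
    apply (prodLeft R R B B' M).injective
    rw [cone_tensor, hpe, h.cyc M m hm, map_zero, map_zero, sub_zero]
    refine Prod.ext rfl ?_
    apply (loc_bij f (l.rTensor M) k).1
    simp only
    rw [← map_smul, ← tmul_smul, hk, tmul_zero, map_zero]
    exact (smul_zero _).symm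
  · intro M _ _ m c hm hc
    rw [Tor.sup_iff] at hm
    have h1 := congrArg (fun z => (prodLeft R R B B' M z).1) hc
    simp only [cone_tensor, hpe] at h1
    exact h.inj M m _ hm.1 h1
  · intro M _ _ hM c hc
    have := hloc M
    have h1 := congrArg (fun z => prodLeft R R B B' M z) hc
    simp only [cone_tensor, map_zero] at h1
    obtain ⟨h1, h2⟩ := Prod.ext_iff.1 h1
    obtain ⟨m, hm, hk, b, v, hb, hv⟩ := step_ex f (δ.rTensor M) (δ'.rTensor M) (l.rTensor M)
      (TensorProduct.mk R B M e) (hcom M) (fun m hm => h.cyc M m hm) (fun m c hm => h.inj M m c hm)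
      (fun c hc => h.ex M hM c hc) (fun m hm N => inj_ext hM f hm N) _ _ h1 (sub_eq_zero.1 h2)
    refine ⟨m, (Tor.sup_iff f m).2 ⟨hm, hk⟩, (prodLeft R R B B' M).symm (b, v), ?_⟩
    apply (prodLeft R R B B' M).injective
    rw [map_add, cone_tensor, hpe, LinearEquiv.apply_symm_apply]
    refine Prod.ext hb ?_
    rw [hv]
    exact (zero_add _).symm
end CechSec
end
end LCF

namespace LCF
noncomputable section

section CechEx
variable {A : Type u} [CommRing A] {n : ℕ}

open Finset in
lemma comm_ext {M N : DMod A n} (f : MvPolynomial (Fin n) A)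
    (l : M.carrier →ₗ[MvPolynomial (Fin n) A] N.carrier) [IsLocalizedModule (Submonoid.powers f) l]
    (δ : M.carrier →ₗ[MvPolynomial (Fin n) A] M.carrier)
    (δ' : N.carrier →ₗ[MvPolynomial (Fin n) A] N.carrier)
    (hl : ∀ β m, l (M.D.d β m) = N.D.d β (l m)) (hδ : ∀ β m, δ (M.D.d β m) = M.D.d β (δ m))
    (hc : ∀ c, l (δ c) = δ' (l c)) (β) (u) : δ' (N.D.d β u) = N.D.d β (δ' u) := by
  have key : ∀ k : ℕ, ∀ β : Fin n →₀ ℕ, β.degree = k → ∀ u, δ' (N.D.d β u) - N.D.d β (δ' u) = 0 := by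
    intro k
    induction k using Nat.strong_induction_on with
    | _ k ih =>
      intro β hβ u
      have hlin : ∀ p : MvPolynomial (Fin n) A, δ' (N.D.d β (p • u)) - N.D.d β (δ' (p • u)) =
          p • (δ' (N.D.d β u) - N.D.d β (δ' u)) := by
        intro p
        rw [δ'.map_smul, N.D.leibniz, N.D.leibniz, map_sum, ← Finset.sum_sub_distrib]
        rw [Finset.sum_eq_single_of_mem ((0, β) : (Fin n →₀ ℕ) × (Fin n →₀ ℕ))]
        · rw [tay_coeff_zero, map_smul, smul_sub]
        · rw [HasAntidiagonal.mem_antidiagonal, zero_add]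
        · rintro ⟨α, γ⟩ hq hne
          rw [HasAntidiagonal.mem_antidiagonal] at hq
          simp only at hq
          have h1 : α ≠ 0 := by
            rintro rfl
            rw [zero_add] at hq
            exact hne (by rw [hq])
          have h2 : γ.degree < k := by
            have : α.degree ≠ 0 := by rwa [Ne, Finsupp.degree_eq_zero_iff]
            rw [← hβ, ← hq, map_add]
            omega
          rw [map_smul, ← smul_sub, ih _ h2 γ rfl, smul_zero]
      obtain ⟨k, c, hk⟩ := loc_surj f l u
      have h1 := hlin (f ^ k)
      rw [hk, ← hl, ← hc, ← hc, hδ, hl, sub_self] at h1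
      apply (loc_bij f l k).1
      simp only
      rw [← h1, smul_zero]
  exact sub_eq_zero.1 (key _ β rfl u)

theorem exists_cech [IsNoetherianRing A] (I : Ideal (MvPolynomial (Fin n) A)) :
    ∃ B : DMod A n, Good B ∧ ∃ (δ : B.carrier →ₗ[MvPolynomial (Fin n) A] B.carrier) (e : B.carrier),
      (∀ b, δ (δ b) = 0) ∧ (∀ β b, δ (B.D.d β b) = B.D.d β (δ b)) ∧ Cech I δ e := by
  classical
  obtain ⟨s, rfl⟩ := IsNoetherian.noetherian I
  induction s using Finset.induction_on with
  | empty =>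
    let φ := (IsLocalization.atUnit (MvPolynomial (Fin n) A)
      (Localization.Away (1 : MvPolynomial (Fin n) A)) 1 isUnit_one).toLinearEquiv
    refine ⟨DMod.away 1, Good.base _, 0, φ 1, fun _ => rfl, fun β b => ?_, ?_⟩
    · rw [LinearMap.zero_apply, LinearMap.zero_apply, map_zero]
    · rw [Finset.coe_empty, Submodule.span_empty]
      exact Cech.bot φ
  | insert f s _ ih =>
    obtain ⟨B, hB, δ, e, h1, h2, h3⟩ := ih
    obtain ⟨B', hB', l, hl, hl'⟩ := hB.loc f
    let δ' := IsLocalizedModule.map (Submonoid.powers f) l l δ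
    have hc : ∀ c, l (δ c) = δ' (l c) := fun c =>
      (IsLocalizedModule.map_apply (Submonoid.powers f) l l δ c).symm
    have hc2 := comm_ext f l δ δ' hl' h2 hc
    have hsq : ∀ u, δ' (δ' u) = 0 := by
      intro u
      obtain ⟨k, c, hk⟩ := loc_surj f l u
      apply (loc_bij f l k).1
      simp only
      rw [← map_smul, ← map_smul, hk, ← hc, ← hc, h1, map_zero, smul_zero]
    refine ⟨B.prod B', Good.prod _ _ hB hB', cone δ δ' l, (e, 0), ?_, ?_, ?_⟩
    · intro b
      rw [cone_apply, cone_apply]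
      refine Prod.ext (h1 _) ?_
      simp only
      rw [map_sub, hsq, hc, sub_zero, sub_self]; rfl
    · rintro β ⟨b, c⟩
      refine Prod.ext (h2 β b) ?_
      change l (B.D.d β b) - δ' (B'.D.d β c) = B'.D.d β (l b - δ' c)
      rw [hl', hc2, map_sub]
    · rw [Finset.coe_insert]
      have := h3.step δ' f l hc
      rwa [← Ideal.span, ← Ideal.span_insert] at this
end CechEx
end
end LCF

namespace LCF
noncomputable section
open TensorProduct CategoryTheory

section Conn
variable {R : Type u} [CommRing R]

lemma conn {X Y C C' C'' : Type u} [AddCommGroup X] [Module R X] [AddCommGroup Y] [Module R Y]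
    [AddCommGroup C] [Module R C] [AddCommGroup C'] [Module R C'] [AddCommGroup C''] [Module R C'']
    (d : C →ₗ[R] C) (d' : C' →ₗ[R] C') (d'' : C'' →ₗ[R] C'') (f : C →ₗ[R] C') (g : C' →ₗ[R] C'')
    (hdf : ∀ c, f (d c) = d' (f c)) (hdg : ∀ c, g (d' c) = d'' (g c)) (hd' : ∀ c, d' (d' c) = 0)
    (hf : Function.Injective f) (hg : Function.Surjective g) (hfg : Function.Exact f g)
    (T : Submodule R Y) (G : X →ₗ[R] Y ⧸ T) (hG : Function.Injective G)
    (F : Y →ₗ[R] C'' ⧸ LinearMap.range d'')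
    (hF : ∀ y, ∃ z, d'' z = 0 ∧ F y = (LinearMap.range d'').mkQ z)
    (hT : ∀ y, y ∈ T ↔ ∃ c, d' c = 0 ∧ F y = (LinearMap.range d'').mkQ (g c)) :
    ∃ F' : X →ₗ[R] C ⧸ LinearMap.range d, Function.Injective F' ∧
      ∀ x, ∃ w v, F' x = (LinearMap.range d).mkQ w ∧ d w = 0 ∧ f w = d' v := by
  let q := (LinearMap.range d'').mkQ
  have hq : ∀ z, q z = 0 ↔ ∃ b, d'' b = z := by
    intro z
    exact (Submodule.Quotient.mk_eq_zero _)
  let Γ : Submodule R (X × C) :=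
    { carrier := {p | ∃ v y, f p.2 = d' v ∧ F y = q (g v) ∧ G p.1 = T.mkQ y}
      add_mem' := by
        rintro ⟨x, w⟩ ⟨x', w'⟩ ⟨v, y, h1, h2, h3⟩ ⟨v', y', h1', h2', h3'⟩
        simp only at h1 h2 h3 h1' h2' h3'
        refine ⟨v + v', y + y', ?_, ?_, ?_⟩
        · simp only [Prod.mk_add_mk, map_add, h1, h1']
        · simp only [map_add, h2, h2']
        · simp only [Prod.mk_add_mk, map_add, h3, h3']
      zero_mem' := ⟨0, 0, by simp, by simp, by simp⟩
      smul_mem' := by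
        rintro r ⟨x, w⟩ ⟨v, y, h1, h2, h3⟩
        simp only at h1 h2 h3
        refine ⟨r • v, r • y, ?_, ?_, ?_⟩
        · simp only [Prod.smul_mk, map_smul, h1]
        · simp only [map_smul, h2]
        · simp only [Prod.smul_mk, map_smul, h3] }
  have hΓ : ∀ x w, (x, w) ∈ Γ ↔ ∃ v y, f w = d' v ∧ F y = q (g v) ∧ G x = T.mkQ y :=
    fun x w => Iff.rfl
  have tot : ∀ x, ∃ w, (x, w) ∈ Γ := by
    intro x
    obtain ⟨y, hy⟩ := T.mkQ_surjective (G x)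
    obtain ⟨z, hz, hz'⟩ := hF y
    obtain ⟨v, rfl⟩ := hg z
    obtain ⟨w, hw⟩ := (hfg (d' v)).1 (by rw [hdg, hz])
    exact ⟨w, v, y, hw, hz', hy.symm⟩
  obtain ⟨F', h1, h2⟩ := exists_inj_of_rel Γ (LinearMap.range d) tot (by
    intro w hw
    obtain ⟨v, y, h1, h2, h3⟩ := (hΓ _ _).1 hw
    rw [map_zero] at h3
    have hy : y ∈ T := (Submodule.Quotient.mk_eq_zero _).1 h3.symm
    obtain ⟨c, hc, hc'⟩ := (hT y).1 hy
    have h4 : q (g (v - c)) = 0 := by rw [map_sub, map_sub, ← h2, hc', sub_self]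
    obtain ⟨b, hb⟩ := (hq _).1 h4
    obtain ⟨b', rfl⟩ := hg b
    rw [← hdg, eq_comm, ← sub_eq_zero, ← map_sub] at hb
    obtain ⟨w', hw'⟩ := (hfg _).1 hb
    refine ⟨w', hf ?_⟩
    rw [hdf, hw', map_sub, map_sub, hc, hd', sub_zero, sub_zero, h1]) (by
    rintro x w hw ⟨w', rfl⟩
    obtain ⟨v, y, h1, h2, h3⟩ := (hΓ _ _).1 hw
    have hy : y ∈ T := by
      refine (hT y).2 ⟨v - f w', ?_, ?_⟩
      · rw [map_sub, ← hdf, ← h1, sub_self]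
      · rw [h2, map_sub, (hfg _).2 ⟨w', rfl⟩, sub_zero]
    apply hG
    rw [h3, map_zero]
    exact (Submodule.Quotient.mk_eq_zero _).2 hy)
  refine ⟨F', h1, fun x => ?_⟩
  obtain ⟨w, hw⟩ := tot x
  obtain ⟨v, y, h3, h4, h5⟩ := (hΓ _ _).1 hw
  refine ⟨w, v, h2 _ _ hw, hf ?_, h3⟩
  rw [hdf, h3, hd', map_zero]

variable {B : Type u} [AddCommGroup B] [Module R B] {δ : B →ₗ[R] B} {e : B} {I : Ideal R}

lemma Tor.map {M N : Type u} [AddCommGroup M] [Module R M] [AddCommGroup N] [Module R N]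
    (g : M →ₗ[R] N) {m : M} (h : Tor I m) : Tor I (g m) := by
  obtain ⟨t, ht⟩ := h
  exact ⟨t, fun r hr => by rw [← map_smul, ht r hr, map_zero]⟩

lemma Tor.sub {M : Type u} [AddCommGroup M] [Module R M] {m m' : M} (h : Tor I m) (h' : Tor I m') :
    Tor I (m - m') := by
  obtain ⟨t, ht⟩ := h
  obtain ⟨t', ht'⟩ := h'
  exact ⟨t + t', fun r hr => by rw [smul_sub, ht r (Ideal.pow_le_pow_right (by omega) hr),
    ht' r (Ideal.pow_le_pow_right (by omega) hr), sub_zero]⟩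

lemma tens_comm {M N : Type u} [AddCommGroup M] [Module R M] [AddCommGroup N] [Module R N]
    (g : M →ₗ[R] N) (δ : B →ₗ[R] B) (c : B ⊗[R] M) :
    g.lTensor B (δ.rTensor M c) = δ.rTensor N (g.lTensor B c) := by
  rw [← LinearMap.comp_apply, ← LinearMap.comp_apply, LinearMap.lTensor_comp_rTensor,
    LinearMap.rTensor_comp_lTensor]

/-- The boundaries. -/
abbrev bd (δ : B →ₗ[R] B) (M : Type u) [AddCommGroup M] [Module R M] : Submodule R (B ⊗[R] M) :=
  LinearMap.range (δ.rTensor M)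

lemma mkQ_eq_iff {M : Type u} [AddCommGroup M] [Module R M] (c c' : B ⊗[R] M) :
    (bd δ M).mkQ c = (bd δ M).mkQ c' ↔ ∃ b, δ.rTensor M b = c - c' := by
  rw [← sub_eq_zero, ← map_sub]
  exact Submodule.Quotient.mk_eq_zero _

/-- Induction claim. -/
def Claim (δ : B →ₗ[R] B) (I : Ideal R) (i : ℕ) (M : ModuleCat.{u} R) : Prop :=
  ∃ F : LC I i M →ₗ[R] (B ⊗[R] M) ⧸ bd δ M, Function.Injective F ∧
    (∀ x, ∃ z, δ.rTensor M z = 0 ∧ F x = (bd δ M).mkQ z) ∧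
    ∀ (J : ModuleCat.{u} R) (g : J ⟶ M), Injective J → ∀ y,
      (y ∈ LinearMap.range ((localCohomology I i).map g).hom ↔
        ∃ c, δ.rTensor J c = 0 ∧ F y = (bd δ M).mkQ (g.hom.lTensor B c))

lemma inj_mod {J : ModuleCat.{u} R} (h : Injective J) : Module.Injective R J :=
  (Module.injective_iff_injective_object R J).2 h

lemma cyc_image (h : Cech I δ e) {J M : ModuleCat.{u} R} (g : J ⟶ M) (hJ : Injective J)
    (c : B ⊗[R] J) (hc : δ.rTensor J c = 0) : ∃ m : J, Tor I m ∧ 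
      (bd δ M).mkQ (g.hom.lTensor B c) = (bd δ M).mkQ (e ⊗ₜ g.hom m) := by
  obtain ⟨m, hm, b, rfl⟩ := h.ex J (inj_mod hJ) c hc
  refine ⟨m, hm, (mkQ_eq_iff _ _).2 ⟨g.hom.lTensor B b, ?_⟩⟩
  rw [map_add, LinearMap.lTensor_tmul, add_sub_cancel_left, tens_comm]

lemma claim_zero (h : Cech I δ e) (M : ModuleCat.{u} R) : Claim δ I 0 M := by
  have htor : ∀ (M : ModuleCat.{u} R) (x), Tor I (zeta I M x) := fun M x => zeta_mem I M x
  refine ⟨(bd δ M).mkQ.comp ((TensorProduct.mk R B M e).comp (zeta I M)), ?_, ?_, ?_⟩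
  · rw [← LinearMap.ker_eq_bot, LinearMap.ker_eq_bot']
    intro x hx
    have h1 : (bd δ M).mkQ (e ⊗ₜ zeta I M x) = 0 := hx
    obtain ⟨b, hb⟩ := (Submodule.Quotient.mk_eq_zero _).1 h1
    apply zeta_inj
    rw [map_zero]
    exact h.inj M _ b (htor M x) hb
  · intro x
    exact ⟨e ⊗ₜ zeta I M x, h.cyc M _ (htor M x), rfl⟩
  · intro J g hJ y
    constructor
    · rintro ⟨x, rfl⟩
      refine ⟨e ⊗ₜ zeta I J x, h.cyc J _ (htor J x), ?_⟩
      rw [LinearMap.lTensor_tmul, ← zeta_nat]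
      rfl
    · rintro ⟨c, hc, hy⟩
      obtain ⟨m, hm, hm'⟩ := cyc_image h g hJ c hc
      rw [hm'] at hy
      have hy' : (bd δ M).mkQ (e ⊗ₜ zeta I M y) = (bd δ M).mkQ (e ⊗ₜ g.hom m) := hy
      obtain ⟨b, hb⟩ := (mkQ_eq_iff _ _).1 hy'
      rw [← tmul_sub] at hb
      have h1 := h.inj M _ b ((htor M y).sub (hm.map g.hom)) hb
      rw [sub_eq_zero] at h1
      obtain ⟨t, ht⟩ := hm
      obtain ⟨x, rfl⟩ := zeta_surj I J m t ht
      refine ⟨x, ?_⟩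
      apply zeta_inj
      rw [zeta_nat, h1]

lemma claim_succ [Module.Flat R B] (hδ : ∀ b, δ (δ b) = 0) (h : Cech I δ e) (i : ℕ)
    (ih : ∀ M : ModuleCat.{u} R, Claim δ I i M) (M : ModuleCat.{u} R) : Claim δ I (i + 1) M := by
  have hδ' : ∀ (M : Type u) [AddCommGroup M] [Module R M] (c : B ⊗[R] M),
      δ.rTensor M (δ.rTensor M c) = 0 := by
    intro M _ _ c
    have : δ.comp δ = 0 := LinearMap.ext hδ
    rw [← LinearMap.comp_apply, ← LinearMap.rTensor_comp, this, LinearMap.rTensor_zero,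
      LinearMap.zero_apply]
  let J := Injective.under M
  let f : M ⟶ J := Injective.ι M
  let N := Limits.cokernel f
  let g : J ⟶ N := Limits.cokernel.π f
  have hw : f ≫ g = 0 := Limits.cokernel.condition f
  have hex : (ShortComplex.mk f g hw).Exact :=
    ShortComplex.exact_of_g_is_cokernel _ (Limits.cokernelIsCokernel f)
  obtain ⟨G, hG⟩ := LC_shift (I := I) f g hw hex i
  obtain ⟨F, hF1, hF2, hF3⟩ := ih N
  have hfi : Function.Injective f.hom := (ModuleCat.mono_iff_injective f).1 inferInstance
  have hgs : Function.Surjective g.hom := (ModuleCat.epi_iff_surjective g).1 inferInstance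
  have hfg : Function.Exact f.hom g.hom := by
    have := (ShortComplex.ShortExact.moduleCat_exact_iff_function_exact _).1 hex
    exact this
  obtain ⟨F', h1, h2⟩ := conn (δ.rTensor M) (δ.rTensor J) (δ.rTensor N) (f.hom.lTensor B)
    (g.hom.lTensor B) (tens_comm f.hom δ) (tens_comm g.hom δ) (hδ' J)
    (Module.Flat.lTensor_preserves_injective_linearMap f.hom hfi)
    (LinearMap.lTensor_surjective B hgs) (lTensor_exact B hfg hgs) _ G hG F hF2
    (fun y => hF3 J g inferInstance y)
  have triv : ∀ x m, Tor I m → F' x = (bd δ M).mkQ (e ⊗ₜ m) → x = 0 := by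
    intro x m hm hx
    obtain ⟨w, v, hw1, hw2, hw3⟩ := h2 x
    obtain ⟨b, hb⟩ := (mkQ_eq_iff _ _).1 (hw1.symm.trans hx)
    have h3 := congrArg (f.hom.lTensor B) hb
    rw [map_sub, hw3, tens_comm, LinearMap.lTensor_tmul] at h3
    have h4 : f.hom m = 0 := by
      apply h.inj J _ (v - f.hom.lTensor B b) (hm.map f.hom)
      rw [map_sub, h3, sub_sub_cancel]
    have h5 : m = 0 := hfi (by rw [h4, map_zero])
    apply h1
    rw [hx, h5, tmul_zero, map_zero, map_zero]
  refine ⟨F', h1, fun x => ?_, fun J' g' hJ' y => ?_⟩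
  · obtain ⟨w, v, hw1, hw2, hw3⟩ := h2 x
    exact ⟨w, hw2, hw1⟩
  · constructor
    · rintro ⟨x, rfl⟩
      rw [LC_inj i x]
      exact ⟨0, by simp, by simp⟩
    · rintro ⟨c, hc, hy⟩
      obtain ⟨m, hm, hm'⟩ := cyc_image h g' hJ' c hc
      rw [hm'] at hy
      rw [triv y _ (hm.map g'.hom) hy]
      exact zero_mem _

theorem claim_all [Module.Flat R B] (hδ : ∀ b, δ (δ b) = 0) (h : Cech I δ e) (i : ℕ) :
    ∀ M : ModuleCat.{u} R, Claim δ I i M := by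
  induction i with
  | zero => exact claim_zero h
  | succ i ih => exact claim_succ hδ h i ih
end Conn
end
end LCF

namespace LCF
noncomputable section
open TensorProduct CategoryTheory

lemma length_span_le {A M : Type u} [CommRing A] [AddCommGroup M] [Module A M] (π : A)
    (s : Finset M) (h : ∀ m ∈ s, π • m = 0) :
    Module.length A (Submodule.span A (s : Set M)) ≤
      s.card * Module.length A (A ⧸ Ideal.span {π}) := by
  classical
  have hk : ∀ m : s, Ideal.span {π} ≤ LinearMap.ker (LinearMap.toSpanSingleton A M m) := by
    intro m
    rw [Ideal.span_le, Set.singleton_subset_iff, SetLike.mem_coe, LinearMap.mem_ker,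
      LinearMap.toSpanSingleton_apply]
    exact h m m.2
  let Φ : (s → A ⧸ Ideal.span {π}) →ₗ[A] M :=
    LinearMap.lsum A (fun _ : s => A ⧸ Ideal.span {π}) A (fun m => Submodule.liftQ _ _ (hk m))
  have hle : Submodule.span A (s : Set M) ≤ LinearMap.range Φ := by
    rw [Submodule.span_le]
    intro m hm
    refine ⟨Pi.single ⟨m, hm⟩ (Submodule.Quotient.mk 1), ?_⟩
    rw [LinearMap.lsum_piSingle]
    rw [Submodule.liftQ_apply, LinearMap.toSpanSingleton_apply, one_smul]
  refine (Module.length_le_of_injective (Submodule.inclusion hle)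
    (Submodule.inclusion_injective hle)).trans ?_
  refine (Module.length_le_of_surjective Φ.rangeRestrict Φ.surjective_rangeRestrict).trans ?_
  rw [Module.length_pi_of_fintype]
  simp

lemma length_fin {A : Type u} [CommRing A] [IsNoetherianRing A] (π : A)
    (hπ : ringKrullDim (A ⧸ Ideal.span {π}) = 0) :
    ∃ L : ℕ, Module.length A (A ⧸ Ideal.span {π}) = L := by
  have : Ring.KrullDimLE 0 (A ⧸ Ideal.span {π}) := Ring.krullDimLE_iff.2 (by rw [hπ]; rfl)
  have : IsArtinianRing (A ⧸ Ideal.span {π}) := isArtinianRing_iff_krullDimLE_zero.2 this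
  have h1 : Module.length (A ⧸ Ideal.span {π}) (A ⧸ Ideal.span {π}) ≠ ⊤ := Module.length_ne_top
  rw [← Module.length_eq_of_surjective (S := A) Ideal.Quotient.mk_surjective] at h1
  obtain ⟨L, hL⟩ := ENat.ne_top_iff_exists.1 h1
  exact ⟨L, hL.symm⟩

section Ass
variable {A : Type u} [CommRing A] [IsNoetherianRing A] {n : ℕ}

/-- bounded filtrations give finitely many associated primes -/
lemma finite_of_span {M : Type u} [AddCommGroup M] [Module A M]
    [Module (MvPolynomial (Fin n) A) M] [IsScalarTower A (MvPolynomial (Fin n) A) M]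
    (D : DStr A n M) (F : Filt D) (C L : ℕ)
    (h : ∀ i, Module.length A (F.F i) ≤ (C * (i + 1) ^ n : ℕ) * (L : ℕ∞)) :
    (associatedPrimes (MvPolynomial (Fin n) A) M).Finite := by
  refine finite_ass ((8 * (n + 1)) ^ n * (C * L)) M D F 0 fun i _ => ?_
  refine (mul_le_mul_right (h i) _).trans (le_of_eq ?_)
  push_cast
  ring

lemma q2_finite {B : DMod A n} (π : A) (hπ : ringKrullDim (A ⧸ Ideal.span {π}) = 0) 
    (F : Filt B.D) (C : ℕ) (hF : ∀ i, ∃ s : Finset B.carrier, s.card ≤ C * (i + 1) ^ n ∧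
      F.F i = Submodule.span A (s : Set B.carrier))
    (U : Submodule (MvPolynomial (Fin n) A) B.carrier) (hU : ∀ β u, u ∈ U → B.D.d β u ∈ U)
    (hU' : ∀ b, π • b ∈ U) :
    (associatedPrimes (MvPolynomial (Fin n) A) (B.carrier ⧸ U)).Finite := by
  classical
  obtain ⟨L, hL⟩ := length_fin π hπ
  have h0 : ∀ m, U.mkQ m = 0 ↔ m ∈ U := fun m => Submodule.Quotient.mk_eq_zero _
  obtain ⟨D', hD'⟩ := B.D.exists_quot U.mkQ U.mkQ_surjective (fun β m hm =>
    (h0 _).2 (hU β m ((h0 _).1 hm)))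
  refine finite_of_span D' (F.quot U.mkQ U.mkQ_surjective D' hD') C L fun i => ?_
  obtain ⟨s, hs, hs'⟩ := hF i
  have h1 : (F.quot U.mkQ U.mkQ_surjective D' hD').F i =
      Submodule.span A ((s.image U.mkQ : Finset (B.carrier ⧸ U)) : Set (B.carrier ⧸ U)) := by
    change (F.F i).map (U.mkQ.restrictScalars A) = _
    rw [hs', Submodule.map_span, Finset.coe_image]
    rfl
  rw [h1]
  refine (length_span_le π _ ?_).trans ?_
  · intro m hm
    obtain ⟨b, _, rfl⟩ := Finset.mem_image.1 hm
    rw [← LinearMap.map_smul_of_tower]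
    exact (h0 _).2 (hU' b)
  · rw [hL]
    refine mul_le_mul_left ?_ _
    exact_mod_cast Finset.card_image_le.trans hs

lemma q1_finite {B : DMod A n} (hflat : Module.Flat A B.carrier) (π : A)
    (hπ : ringKrullDim (A ⧸ Ideal.span {π}) = 0) 
    (F : Filt B.D) (C : ℕ) (hF : ∀ i, ∃ s : Finset B.carrier, s.card ≤ C * (i + 1) ^ n ∧
      F.F i = Submodule.span A (s : Set B.carrier))
    (W V : Submodule (MvPolynomial (Fin n) A) B.carrier) (hW : ∀ β u, u ∈ W → B.D.d β u ∈ W)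
    (hV : ∀ β u, u ∈ V → B.D.d β u ∈ V)
    (hW' : ∀ b ∈ W, π • b = 0) :
    (associatedPrimes (MvPolynomial (Fin n) A) (W ⧸ V.comap W.subtype)).Finite := by
  classical
  obtain ⟨L, hL⟩ := length_fin π hπ
  let K : Ideal A := LinearMap.ker (LinearMap.lsmul A A π)
  have hK : ∀ a, a ∈ K ↔ π * a = 0 := fun a => Iff.rfl
  obtain ⟨t, ht⟩ := IsNoetherian.noetherian K
  obtain ⟨D₁, hD₁⟩ := B.D.exists_sub W.subtype W.subtype_injective
    (fun β x => ⟨⟨_, hW β x x.2⟩, rfl⟩)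
  have hKd : ∀ (φ : B.carrier →ₗ[A] B.carrier) i j, (∀ m ∈ F.F i, φ m ∈ F.F j) →
      ∀ m ∈ K • F.F i, φ m ∈ K • F.F j := by
    intro φ i j h m hm
    refine Submodule.smul_induction_on hm ?_ ?_
    · intro r hr m hm
      rw [map_smul]
      exact Submodule.smul_mem_smul hr (h m hm)
    · intro x y hx hy
      rw [map_add]
      exact add_mem hx hy
  have hKm : ∀ i j, i ≤ j → K • F.F i ≤ K • F.F j := fun i j hij =>
    Submodule.smul_mono le_rfl (F.mono hij)
  let F₁ : Filt D₁ :=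
    { F := fun i => (K • F.F i).comap (W.subtype.restrictScalars A)
      mono := fun i j hij => Submodule.comap_mono (hKm i j hij)
      X_mem := by
        intro i j m hm
        exact hKd ((LinearMap.lsmul (MvPolynomial (Fin n) A) B.carrier
          (MvPolynomial.X j)).restrictScalars A) i (i + 1) (fun m hm => F.X_mem i j m hm) _ hm
      d_mem := by
        intro i β m hm
        rw [Submodule.mem_comap, LinearMap.restrictScalars_apply, hD₁]
        exact hKd (B.D.d β) i _ (fun m hm => F.d_mem i β m hm) _ hm
      ex := by
        intro m
        have h1 : ∑ i : Fin 1, (fun _ => π) i • (fun _ => (m : B.carrier)) i = 0 := by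
          simp [hW' m m.2]
        obtain ⟨k, a, y, h2, h3⟩ := Module.Flat.isTrivialRelation_of_sum_smul_eq_zero h1
        choose f hf using fun j => F.ex (y j)
        refine ⟨∑ j, f j, ?_⟩
        rw [Submodule.mem_comap]
        change (m : B.carrier) ∈ _
        have h4 := h2 0
        simp only at h4
        rw [h4]
        refine Submodule.sum_mem _ fun j _ => Submodule.smul_mem_smul ?_ ?_
        · have := h3 j
          rw [hK]
          simpa using this
        · exact F.mono (Finset.single_le_sum (fun _ _ => Nat.zero_le _) (Finset.mem_univ j)) (hf j) }
  let U := V.comap W.subtype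
  have h0 : ∀ m, U.mkQ m = 0 ↔ (m : B.carrier) ∈ V := fun m => Submodule.Quotient.mk_eq_zero _
  obtain ⟨D₂, hD₂⟩ := D₁.exists_quot U.mkQ U.mkQ_surjective (fun β m hm => by
    rw [h0] at hm ⊢
    have := hD₁ β m
    rw [Submodule.subtype_apply, Submodule.subtype_apply] at this
    rw [this]
    exact hV β _ hm)
  refine finite_of_span D₂ (F₁.quot U.mkQ U.mkQ_surjective D₂ hD₂) (C * t.card) L fun i => ?_
  obtain ⟨s, hs, hs'⟩ := hF i
  have e1 : Module.length A ((F₁.quot U.mkQ U.mkQ_surjective D₂ hD₂).F i) ≤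
      Module.length A (F₁.F i) := by
    change Module.length A ((F₁.F i).map (U.mkQ.restrictScalars A)) ≤ _
    exact Module.length_le_of_surjective _
      (LinearMap.submoduleMap_surjective (U.mkQ.restrictScalars A) (F₁.F i))
  have e2 : Module.length A (F₁.F i) ≤ Module.length A ↥(K • F.F i) := by
    refine Module.length_le_of_injective
      ((W.subtype.restrictScalars A).restrict (p := F₁.F i) (q := K • F.F i) (fun x hx => hx)) ?_
    intro x y hxy
    apply Subtype.ext
    apply Subtype.ext
    exact congrArg (fun w : ↥(K • F.F i) => (w : B.carrier)) hxy
  let v : Finset B.carrier := Finset.image₂ (fun a b => a • b) t s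
  have e3 : K • F.F i = Submodule.span A (v : Set B.carrier) := by
    rw [hs', ← ht, Finset.coe_image₂]
    apply Submodule.span_smul_span
  refine e1.trans (e2.trans ?_)
  rw [e3]
  refine (length_span_le π _ ?_).trans ?_
  · intro m hm
    obtain ⟨a, ha, b, hb, rfl⟩ := Finset.mem_image₂.1 hm
    have : a ∈ K := by rw [← ht]; exact Submodule.subset_span ha
    rw [smul_smul, (hK a).1 this, zero_smul]
  · rw [hL]
    refine mul_le_mul_left ?_ _
    have h1 : v.card ≤ C * t.card * (i + 1) ^ n := by
      calc v.card ≤ t.card * s.card := Finset.card_image₂_le _ _ _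
        _ ≤ t.card * (C * (i + 1) ^ n) := Nat.mul_le_mul_left _ hs
        _ = _ := by ring
    exact_mod_cast h1

theorem main (π : A) (hπ : ringKrullDim (A ⧸ Ideal.span {π}) = 0)
    (I : Ideal (MvPolynomial (Fin n) A)) (i : ℕ) :
    {P ∈ associatedPrimes (MvPolynomial (Fin n) A)
      ((localCohomology I i).obj (ModuleCat.of _ (MvPolynomial (Fin n) A))) |
      algebraMap A (MvPolynomial (Fin n) A) π ∈ P}.Finite := by
  obtain ⟨B, hB, δ, e, hδ, hδd, hC⟩ := exists_cech I
  have hfl := hB.flat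
  have hflA : Module.Flat A B.carrier := Module.Flat.trans A (MvPolynomial (Fin n) A) B.carrier
  obtain ⟨F, C, hF⟩ := hB.filt
  obtain ⟨G, hG, hG', -⟩ := claim_all hδ hC i (ModuleCat.of _ (MvPolynomial (Fin n) A))
  let πm : B.carrier →ₗ[MvPolynomial (Fin n) A] B.carrier :=
    LinearMap.lsmul _ B.carrier (algebraMap A (MvPolynomial (Fin n) A) π)
  have hπm : ∀ b, πm b = π • b := fun b => algebraMap_smul _ π b
  let W := LinearMap.ker πm ⊓ LinearMap.ker δ
  let V := LinearMap.range δ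
  let U := LinearMap.range πm ⊔ LinearMap.ker δ
  have f1 := q1_finite hflA π hπ F C hF W V
    (by
      rintro β u ⟨h1, h2⟩
      rw [SetLike.mem_coe, LinearMap.mem_ker] at h1 h2
      refine ⟨?_, ?_⟩
      · rw [SetLike.mem_coe, LinearMap.mem_ker, hπm, ← map_smul, ← hπm, h1, map_zero]
      · rw [SetLike.mem_coe, LinearMap.mem_ker, hδd, h2, map_zero])
    (by
      rintro β _ ⟨u, rfl⟩
      exact ⟨_, hδd β u⟩)
    (by
      rintro b ⟨h1, h2⟩
      rw [← hπm]
      exact h1)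
  have f2 := q2_finite π hπ F C hF U
    (by
      intro β u hu
      obtain ⟨_, ⟨a, rfl⟩, b, hb, rfl⟩ := Submodule.mem_sup.1 hu
      rw [map_add]
      refine add_mem (Submodule.mem_sup_left ⟨B.D.d β a, ?_⟩) (Submodule.mem_sup_right ?_)
      · rw [hπm, hπm, map_smul]
      · rw [LinearMap.mem_ker] at hb ⊢
        rw [hδd, hb, map_zero])
    (fun b => Submodule.mem_sup_left ⟨b, hπm b⟩)
  refine (f1.union f2).subset ?_
  rintro P ⟨hP, hπP⟩
  have hP' : IsAssociatedPrime P _ := hP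
  rw [isAssociatedPrime_iff] at hP'
  obtain ⟨hprime, x, hx⟩ := hP'
  obtain ⟨z', hz', hxz⟩ := hG' x
  let ρ := TensorProduct.rid (MvPolynomial (Fin n) A) B.carrier
  have hρ : ∀ c, ρ (δ.rTensor (MvPolynomial (Fin n) A) c) = δ (ρ c) := by
    intro c
    induction c with
    | zero => simp
    | add x y hx hy => simp only [map_add, hx, hy]
    | tmul b r => simp [ρ]
  let z := ρ z'
  have hz : δ z = 0 := by rw [← hρ]; exact (congrArg ρ hz').trans (map_zero ρ)
  have hPz : ∀ r, r ∈ P ↔ r • z ∈ V := by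
    intro r
    rw [hx, Submodule.mem_colon_singleton, Submodule.mem_bot]
    have h1 : r • x = 0 ↔ G (r • x) = 0 := by
      constructor
      · intro h; rw [h, map_zero]
      · intro h; exact hG (by rw [h, map_zero])
    rw [h1, map_smul, hxz, ← map_smul]
    rw [Submodule.mkQ_apply, Submodule.Quotient.mk_eq_zero]
    constructor
    · rintro ⟨c, hc⟩
      exact ⟨ρ c, by rw [← hρ, ← map_smul]; exact congrArg ρ hc⟩
    · rintro ⟨c, hc⟩
      refine ⟨ρ.symm c, ρ.injective ?_⟩
      refine (hρ _).trans ?_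
      rw [LinearEquiv.apply_symm_apply, hc]
      exact (map_smul ρ r z').symm
  obtain ⟨w, hw⟩ := (hPz _).1 hπP
  have hw' : δ w = πm z := hw
  by_cases hcase : ∃ r, r ∉ P ∧ ∃ b c, πm b = 0 ∧ r • z = b + δ c
  · left
    obtain ⟨r, hr, b, c, hb, hrz⟩ := hcase
    have hbδ : δ b = 0 := by
      have := congrArg δ hrz
      rw [map_smul, hz, smul_zero, map_add, hδ, add_zero] at this
      exact this.symm
    let b' : W := ⟨b, hb, hbδ⟩
    change IsAssociatedPrime P _
    rw [isAssociatedPrime_iff]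
    refine ⟨hprime, (V.comap W.subtype).mkQ b', ?_⟩
    ext s
    rw [Submodule.mem_colon_singleton, Submodule.mem_bot, ← map_smul, Submodule.mkQ_apply,
      Submodule.Quotient.mk_eq_zero]
    change s ∈ P ↔ s • b ∈ V
    have h1 : s • b ∈ V ↔ (s * r) • z ∈ V := by
      rw [mul_smul, hrz, smul_add, ← map_smul]
      exact (Submodule.add_mem_iff_left V ⟨_, rfl⟩).symm
    rw [h1, ← hPz]
    exact ⟨fun h => Ideal.mul_mem_right _ _ h, fun h => (hprime.mem_or_mem h).resolve_right hr⟩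
  · right
    change IsAssociatedPrime P _
    rw [isAssociatedPrime_iff]
    refine ⟨hprime, U.mkQ w, ?_⟩
    ext s
    rw [Submodule.mem_colon_singleton, Submodule.mem_bot, ← map_smul, Submodule.mkQ_apply,
      Submodule.Quotient.mk_eq_zero]
    have hcomm : ∀ c, δ (πm c) = πm (δ c) := fun c => map_smul δ _ c
    constructor
    · intro hs
      obtain ⟨c, hc⟩ := (hPz s).1 hs
      have h1 : s • w = πm c + (s • w - πm c) := by abel
      rw [h1]
      refine add_mem (Submodule.mem_sup_left ⟨c, rfl⟩) (Submodule.mem_sup_right ?_)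
      rw [LinearMap.mem_ker, map_sub, map_smul, hw', hcomm, hc, map_smul, sub_self]
    · intro hs
      obtain ⟨_, ⟨c, rfl⟩, k, hk, hck⟩ := Submodule.mem_sup.1 hs
      by_contra hsP
      refine hcase ⟨s, hsP, s • z - δ c, c, ?_, by abel⟩
      have h1 := congrArg δ hck
      rw [map_add, LinearMap.mem_ker.1 hk, add_zero, hcomm, map_smul, hw'] at h1
      rw [map_sub, map_smul, h1, sub_self]
end Ass
end
end LCF

theorem associatedPrimes_containing_pi_localCohomology_finite_of_dim_one_polynomial
    (A : Type u) [CommRing A] [IsNoetherianRing A] (hA : ringKrullDim A = 1)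
    (π : A) (hπ : ringKrullDim (A ⧸ Ideal.span {π}) = 0)
    (n : ℕ) (I : Ideal (MvPolynomial (Fin n) A)) (i : ℕ) :
    {P ∈ associatedPrimes (MvPolynomial (Fin n) A)
        ((localCohomology I i).obj (ModuleCat.of _ (MvPolynomial (Fin n) A))) |
      algebraMap A (MvPolynomial (Fin n) A) π ∈ P}.Finite := by
  exact LCF.main π hπ I i
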